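/- For every integer d ≥ 1 there exists a constant C_d > 0 depending only on d such that the following holds for all sufficiently large even n (with the threshold depending only on d and t). Let t ≥ 1 be a real number and let f be a multilinear polynomial of degree at most d on n variables all of whose coefficients f̂(S) are integer multiples of 2^{−d}. Then at least one of the following holds: (i) there exists α ∈ {−1,1}^n with Σ_{i=1}^n α_i = 0 and f(α) ≥ E_D[f] + t; or (ii) there exists a multilinear polynomial h of degree at most d−1 such that the polynomial f − f̂(∅) − (Σ_{i=1}^n x_i)·h, expanded as a multilinear polynomial over {−1,1}^n, has at most C_d·t² active variables (i.e., at most C_d·t² indices i such that some coefficient on a set containing i is nonzero). -/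

import Mathlib

open Finset

/-- Evaluation of a multilinear polynomial given its coefficients. -/
noncomputable def evalML {n : ℕ} (c : Finset (Fin n) → ℝ) (x : Fin n → ℝ) : ℝ :=
  ∑ S : Finset (Fin n), c S * ∏ i ∈ S, x i

/-- The ±1 assignment corresponding to a Boolean assignment. -/
def signs {n : ℕ} (σ : Fin n → Bool) : Fin n → ℝ := fun i => if σ i then 1 else -1

/-- The (integer) sum of the ±1 values of an assignment. -/
def intSum {n : ℕ} (σ : Fin n → Bool) : ℤ := ∑ i, (if σ i then (1 : ℤ) else -1)

/-- The set of assignments satisfying the bisection constraint `∑ i x i = 0`. -/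
def bisSet (n : ℕ) : Finset (Fin n → Bool) := Finset.univ.filter fun σ => intSum σ = 0

/-- Expectation of `g` over the uniform distribution on `A`. -/
noncomputable def expOver {n : ℕ} (A : Finset (Fin n → Bool)) (g : (Fin n → Bool) → ℝ) : ℝ :=
  (∑ σ ∈ A, g σ) / A.card

/-- Coefficient at `T` of the multilinear expansion of `(∑ i, x i) * h` (using `x i ^ 2 = 1`). -/
noncomputable def mulSum {n : ℕ} (h : Finset (Fin n) → ℝ) (T : Finset (Fin n)) : ℝ :=
  ∑ i : Fin n, h (symmDiff T {i})

section Characters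

variable {ι : Type*}

/-- The real sign `±1` of a Boolean. -/
def boolSign (b : Bool) : ℝ := if b then 1 else -1

@[simp] lemma boolSign_mul_self (b : Bool) : boolSign b * boolSign b = 1 := by
  cases b <;> simp [boolSign]

@[simp] lemma boolSign_not (b : Bool) : boolSign (!b) = -boolSign b := by
  cases b <;> simp [boolSign]

/-- The character `x ↦ ∏ i ∈ S, x i` on the cube. -/
def chi (S : Finset ι) : (ι → Bool) → ℝ := fun x => ∏ i ∈ S, boolSign (x i)

/-- The coordinate function `x ↦ x i` with values `±1`. -/
def coord (i : ι) : (ι → Bool) → ℝ := fun x => boolSign (x i)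

lemma coord_mul_self (i : ι) : coord i * coord i = 1 := by
  ext x; simp [coord]

lemma chi_empty : chi (∅ : Finset ι) = 1 := by
  ext x; simp [chi]

/-- Polynomials of degree less than `d` in the variables of `U`, as functions on the cube. -/
def polyLT (U : Finset ι) (d : ℕ) : Submodule ℝ ((ι → Bool) → ℝ) :=
  Submodule.span ℝ {f | ∃ S ⊆ U, S.card < d ∧ f = chi S}

lemma chi_mem_polyLT {U S : Finset ι} {d : ℕ} (hS : S ⊆ U) (hd : S.card < d) :
    chi S ∈ polyLT U d :=
  Submodule.subset_span ⟨S, hS, hd, rfl⟩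

lemma polyLT_induction {U : Finset ι} {d : ℕ} {p : ((ι → Bool) → ℝ) → Prop}
    (hchi : ∀ S ⊆ U, S.card < d → p (chi S)) (hzero : p 0)
    (hadd : ∀ f g, p f → p g → p (f + g)) (hsmul : ∀ (r : ℝ) f, p f → p (r • f))
    {f : (ι → Bool) → ℝ} (hf : f ∈ polyLT U d) : p f := by
  refine Submodule.span_induction (p := fun f _ => p f) ?_ hzero
    (fun f g _ _ => hadd f g) (fun r f _ => hsmul r f) hf
  rintro _ ⟨S, hS, hd, rfl⟩
  exact hchi S hS hd

lemma polyLT_mono {U V : Finset ι} {d e : ℕ} (hUV : U ⊆ V) (hde : d ≤ e) :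
    polyLT U d ≤ polyLT V e := by
  refine Submodule.span_mono ?_
  rintro _ ⟨S, hS, hd, rfl⟩
  exact ⟨S, hS.trans hUV, hd.trans_le hde, rfl⟩

lemma polyLT_zero {U : Finset ι} {f : (ι → Bool) → ℝ} (hf : f ∈ polyLT U 0) : f = 0 := by
  refine polyLT_induction (p := fun f => f = 0) ?_ rfl ?_ ?_ hf
  · intro S _ h; simp at h
  · rintro f g rfl rfl; simp
  · rintro r f rfl; simp

lemma one_mem_polyLT {U : Finset ι} {d : ℕ} (hd : 0 < d) :
    (1 : (ι → Bool) → ℝ) ∈ polyLT U d := by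
  rw [← chi_empty]
  exact chi_mem_polyLT (by simp) (by simpa)

lemma apply_eq_of_mem_polyLT {U : Finset ι} {d : ℕ} {f : (ι → Bool) → ℝ} (hf : f ∈ polyLT U d)
    {x y : ι → Bool} (hxy : ∀ i ∈ U, x i = y i) : f x = f y := by
  refine polyLT_induction (p := fun f => f x = f y) ?_ rfl ?_ ?_ hf
  · intro S hS _
    exact Finset.prod_congr rfl fun i hi => by rw [hxy i (hS hi)]
  · intro f g hf hg; simp [hf, hg]
  · intro r f hf; simp [hf]

lemma polyLT_one {U : Finset ι} {f : (ι → Bool) → ℝ} (hf : f ∈ polyLT U 1) (x y : ι → Bool) :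
    f x = f y := by
  refine polyLT_induction (p := fun f => f x = f y) ?_ rfl ?_ ?_ hf
  · intro S hS h
    have : S = ∅ := by simpa using h
    simp [this, chi_empty]
  · intro f g hf hg; simp [hf, hg]
  · intro r f hf; simp [hf]

lemma chi_comp_perm (S : Finset ι) (ρ : Equiv.Perm ι) (x : ι → Bool) :
    chi S (x ∘ ρ) = chi (S.map ρ.toEmbedding) x := by
  simp [chi]

lemma polyLT_comp_perm {U : Finset ι} {d : ℕ} {f : (ι → Bool) → ℝ} (hf : f ∈ polyLT U d)
    {ρ : Equiv.Perm ι} (hρ : ∀ i ∈ U, ρ i ∈ U) : (fun x : ι → Bool => f (x ∘ ρ)) ∈ polyLT U d := by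
  refine polyLT_induction (p := fun f => (fun x : ι → Bool => f (x ∘ ρ)) ∈ polyLT U d)
    ?_ ?_ ?_ ?_ hf
  · intro S hS h
    simp_rw [chi_comp_perm]
    refine chi_mem_polyLT ?_ (by simpa)
    intro i hi
    obtain ⟨j, hj, rfl⟩ := Finset.mem_map.1 hi
    exact hρ j (hS hj)
  · exact Submodule.zero_mem _
  · exact fun f g hf hg => Submodule.add_mem _ hf hg
  · exact fun r f hf => Submodule.smul_mem _ r hf

variable [DecidableEq ι]

lemma chi_insert {i : ι} {S : Finset ι} (h : i ∉ S) : chi (insert i S) = coord i * chi S := by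
  ext x
  simp [coord, chi, Finset.prod_insert h]

lemma coord_mul_chi (i : ι) (S : Finset ι) : coord i * chi S = chi (symmDiff S {i}) := by
  by_cases h : i ∈ S
  · have : symmDiff S {i} = S.erase i := by
      ext j; simp only [Finset.mem_symmDiff, Finset.mem_singleton, Finset.mem_erase]; grind
    rw [this]
    conv_lhs => rw [← Finset.insert_erase h, chi_insert (Finset.notMem_erase i S), ← mul_assoc,
      coord_mul_self, one_mul]
  · have : symmDiff S {i} = insert i S := by
      ext j; simp only [Finset.mem_symmDiff, Finset.mem_singleton, Finset.mem_insert]; grind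
    rw [this, chi_insert h]

lemma chi_mul_chi (S T : Finset ι) : chi S * chi T = chi (symmDiff S T) := by
  induction T using Finset.induction_on generalizing S with
  | empty => rw [chi_empty, mul_one, ← Finset.bot_eq_empty, symmDiff_bot]
  | insert i T hi ih =>
    rw [chi_insert hi, ← mul_assoc, mul_comm (chi S), coord_mul_chi, ih, symmDiff_assoc]
    congr 2
    ext j; simp only [Finset.mem_symmDiff, Finset.mem_singleton, Finset.mem_insert]; grind

/-- Splitting a polynomial according to its dependence on one variable. -/
lemma exists_eq_add_coord_mul {U : Finset ι} {i : ι} {d : ℕ} {f : (ι → Bool) → ℝ}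
    (hf : f ∈ polyLT (insert i U) (d + 1)) :
    ∃ a ∈ polyLT U (d + 1), ∃ b ∈ polyLT U d, f = a + coord i * b := by
  refine polyLT_induction
    (p := fun f => ∃ a ∈ polyLT U (d + 1), ∃ b ∈ polyLT U d, f = a + coord i * b) ?_ ?_ ?_ ?_ hf
  · intro S hS h
    by_cases hi : i ∈ S
    · refine ⟨0, Submodule.zero_mem _, chi (S.erase i), chi_mem_polyLT ?_ ?_, ?_⟩
      · intro j hj
        have := hS (Finset.mem_of_mem_erase hj)
        grind
      · rw [Finset.card_erase_of_mem hi]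
        have := Finset.card_pos.2 ⟨i, hi⟩
        omega
      · rw [zero_add, ← chi_insert (Finset.notMem_erase i S), Finset.insert_erase hi]
    · refine ⟨chi S, chi_mem_polyLT ?_ h, 0, Submodule.zero_mem _, by simp⟩
      intro j hj
      have := hS hj
      grind
  · exact ⟨0, Submodule.zero_mem _, 0, Submodule.zero_mem _, by simp⟩
  · rintro _ _ ⟨a, ha, b, hb, rfl⟩ ⟨a', ha', b', hb', rfl⟩
    exact ⟨_, Submodule.add_mem _ ha ha', _, Submodule.add_mem _ hb hb', by ring⟩
  · rintro r _ ⟨a, ha, b, hb, rfl⟩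
    refine ⟨_, Submodule.smul_mem _ r ha, _, Submodule.smul_mem _ r hb, ?_⟩
    rw [smul_add, mul_smul_comm]

/-- Negating one coordinate. -/
def flipAt (i : ι) (x : ι → Bool) : ι → Bool := Function.update x i (!x i)

lemma flipAt_involutive (i : ι) : Function.Involutive (flipAt i : (ι → Bool) → ι → Bool) := by
  intro x; ext j; by_cases h : j = i
  · subst h; simp [flipAt]
  · simp [flipAt, h]

lemma chi_flipAt {i : ι} {S : Finset ι} (hi : i ∉ S) (x : ι → Bool) :
    chi S (flipAt i x) = chi S x := by
  refine Finset.prod_congr rfl fun j hj => ?_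
  rw [flipAt, Function.update_of_ne (by rintro rfl; exact hi hj)]

end Characters

section Mean

variable {ι : Type*} [Fintype ι] [DecidableEq ι]

/-- The uniform average over the cube. -/
noncomputable def cubeMean : ((ι → Bool) → ℝ) →ₗ[ℝ] ℝ :=
  (Fintype.card (ι → Bool) : ℝ)⁻¹ • ∑ x, LinearMap.proj x

lemma cubeMean_apply (f : (ι → Bool) → ℝ) :
    cubeMean f = (Fintype.card (ι → Bool) : ℝ)⁻¹ * ∑ x, f x := by
  simp [cubeMean]

lemma card_cube_pos : (0 : ℝ) < Fintype.card (ι → Bool) := by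
  exact_mod_cast Fintype.card_pos

lemma cubeMean_const (r : ℝ) : cubeMean (fun _ : ι → Bool => r) = r := by
  have := (card_cube_pos (ι := ι)).ne'
  rw [cubeMean_apply, Finset.sum_const, Finset.card_univ, nsmul_eq_mul, inv_mul_cancel_left₀ this]

lemma cubeMean_mono {f g : (ι → Bool) → ℝ} (h : ∀ x, f x ≤ g x) : cubeMean f ≤ cubeMean g := by
  rw [cubeMean_apply, cubeMean_apply]
  gcongr with x
  exact h x

lemma cubeMean_nonneg {f : (ι → Bool) → ℝ} (h : ∀ x, 0 ≤ f x) : 0 ≤ cubeMean f := by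
  rw [cubeMean_apply]
  exact mul_nonneg (by positivity) (Finset.sum_nonneg fun x _ => h x)

lemma cubeMean_sq_le {f g h : (ι → Bool) → ℝ} (hf : ∀ x, 0 ≤ f x) (hg : ∀ x, 0 ≤ g x)
    (hfg : ∀ x, h x ^ 2 = f x * g x) : cubeMean h ^ 2 ≤ cubeMean f * cubeMean g := by
  simp only [cubeMean_apply]
  have := Finset.sum_sq_le_sum_mul_sum_of_sq_le_mul Finset.univ (fun x _ => hf x)
    (fun x _ => hg x) (fun x _ => (hfg x).le)
  have h2 := mul_le_mul_of_nonneg_left this (sq_nonneg (Fintype.card (ι → Bool) : ℝ)⁻¹)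
  calc _ = _ := by ring
    _ ≤ _ := h2
    _ = _ := by ring

lemma cubeMean_coord_mul {i : ι} {g : (ι → Bool) → ℝ} (hg : ∀ x, g (flipAt i x) = g x) :
    cubeMean (coord i * g) = 0 := by
  have h : ∑ x, (coord i * g) x = ∑ x, -(coord i * g) x := by
    refine Fintype.sum_equiv (flipAt_involutive i).toPerm _ _ fun x => ?_
    have hx : flipAt i x i = !x i := by simp [flipAt]
    simp [coord, hg, hx]
  rw [Finset.sum_neg_distrib] at h
  rw [cubeMean_apply, show ∑ x, (coord i * g) x = 0 by linarith, mul_zero]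

lemma cubeMean_chi (S : Finset ι) : cubeMean (chi S) = if S = ∅ then 1 else 0 := by
  split_ifs with h
  · subst h
    rw [chi_empty]
    exact cubeMean_const 1
  · obtain ⟨i, hi⟩ := Finset.nonempty_iff_ne_empty.2 h
    rw [← Finset.insert_erase hi, chi_insert (Finset.notMem_erase i S)]
    exact cubeMean_coord_mul (chi_flipAt (Finset.notMem_erase i S))

lemma cubeMean_chi_mul_chi (S T : Finset ι) :
    cubeMean (chi S * chi T) = if S = T then 1 else 0 := by
  rw [chi_mul_chi, cubeMean_chi]
  simp

/-- The Bonami hypercontractive inequality between the second and the fourth moments. -/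
lemma cubeMean_pow_four_le (U : Finset ι) (d : ℕ) {f : (ι → Bool) → ℝ} (hf : f ∈ polyLT U d) :
    cubeMean (f ^ 4) ≤ 9 ^ d * cubeMean (f ^ 2) ^ 2 := by
  induction U using Finset.induction_on generalizing d f with
  | empty =>
    have h1 : f = fun _ => f (fun _ => true) := by
      ext x; exact apply_eq_of_mem_polyLT hf (by simp)
    set r := f (fun _ => true)
    have h2 : f ^ 2 = fun _ => r ^ 2 := by rw [h1]; rfl
    have h4 : f ^ 4 = fun _ => r ^ 4 := by rw [h1]; rfl
    rw [h2, h4, cubeMean_const, cubeMean_const, ← pow_mul]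
    exact le_mul_of_one_le_left (by positivity) (one_le_pow₀ (by norm_num))
  | insert i U hi ih =>
    cases d with
    | zero => rw [polyLT_zero hf]; simp
    | succ d =>
      obtain ⟨a, ha, b, hb, rfl⟩ := exists_eq_add_coord_mul hf
      have hflip : ∀ x : ι → Bool, ∀ j ∈ U, flipAt i x j = x j := by
        intro x j hj
        rw [flipAt, Function.update_of_ne (by rintro rfl; exact hi hj)]
      have ha' : ∀ x, a (flipAt i x) = a x := fun x => apply_eq_of_mem_polyLT ha (hflip x)
      have hb' : ∀ x, b (flipAt i x) = b x := fun x => apply_eq_of_mem_polyLT hb (hflip x)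
      have hs := coord_mul_self i
      have e2 : (a + coord i * b) ^ 2 = a ^ 2 + b ^ 2 + coord i * (2 * a * b) := by
        linear_combination b ^ 2 * hs
      have e4 : (a + coord i * b) ^ 4 = a ^ 4 + (6 : ℝ) • (a * b) ^ 2 + b ^ 4
          + coord i * (4 * a ^ 3 * b + 4 * a * b ^ 3) := by
        have : (6 : ℝ) • (a * b) ^ 2 = 6 * (a * b) ^ 2 := by
          ext x; simp
        rw [this]
        linear_combination (6 * a ^ 2 * b ^ 2 + 4 * a * b ^ 3 * coord i
          + b ^ 4 * (coord i * coord i + 1)) * hs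
      have m2 : cubeMean ((a + coord i * b) ^ 2) = cubeMean (a ^ 2) + cubeMean (b ^ 2) := by
        rw [e2, map_add, map_add, cubeMean_coord_mul, add_zero]
        intro x; simp [ha', hb']
      have m4 : cubeMean ((a + coord i * b) ^ 4)
          = cubeMean (a ^ 4) + 6 * cubeMean ((a * b) ^ 2) + cubeMean (b ^ 4) := by
        rw [e4, map_add, map_add, map_add, map_smul, smul_eq_mul, cubeMean_coord_mul, add_zero]
        intro x; simp [ha', hb']
      have iha := ih (d + 1) ha
      have ihb := ih d hb
      have cs : cubeMean ((a * b) ^ 2) ^ 2 ≤ cubeMean (a ^ 4) * cubeMean (b ^ 4) := by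
        refine cubeMean_sq_le ?_ ?_ ?_
        · intro x; simp only [Pi.pow_apply]; positivity
        · intro x; simp only [Pi.pow_apply]; positivity
        · intro x; simp only [Pi.pow_apply, Pi.mul_apply]; ring
      have nA : 0 ≤ cubeMean (a ^ 2) := cubeMean_nonneg fun x => by
        simp only [Pi.pow_apply]; positivity
      have nB : 0 ≤ cubeMean (b ^ 2) := cubeMean_nonneg fun x => by
        simp only [Pi.pow_apply]; positivity
      have nB4 : 0 ≤ cubeMean (b ^ 4) := cubeMean_nonneg fun x => by
        simp only [Pi.pow_apply]; positivity
      rw [m2, m4]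
      set A := cubeMean (a ^ 2)
      set B := cubeMean (b ^ 2)
      have hM : cubeMean ((a * b) ^ 2) ≤ 3 * 9 ^ d * A * B := by
        refine le_of_sq_le_sq ?_ (by positivity)
        calc _ ≤ _ := cs
          _ ≤ (9 ^ (d + 1) * A ^ 2) * (9 ^ d * B ^ 2) := by gcongr
          _ = _ := by ring
      calc _ ≤ 9 ^ (d + 1) * A ^ 2 + 6 * (3 * 9 ^ d * A * B) + 9 ^ d * B ^ 2 := by gcongr
        _ ≤ _ := by
          have : 0 ≤ (9 : ℝ) ^ d * B ^ 2 := by positivity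
          rw [pow_succ]
          nlinarith

/-- The Hölder inequality between the first, second and fourth moments. -/
lemma sum_sq_pow_three_le {α : Type*} (s : Finset α) {u : α → ℝ} (hu : ∀ a ∈ s, 0 ≤ u a) :
    (∑ a ∈ s, u a ^ 2) ^ 3 ≤ (∑ a ∈ s, u a) ^ 2 * ∑ a ∈ s, u a ^ 4 := by
  have h1 : (∑ a ∈ s, u a ^ 2) ^ 2 ≤ (∑ a ∈ s, u a) * ∑ a ∈ s, u a ^ 3 :=
    Finset.sum_sq_le_sum_mul_sum_of_sq_le_mul s hu (fun a ha => pow_nonneg (hu a ha) 3)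
      fun a _ => le_of_eq (by ring)
  have h2 : (∑ a ∈ s, u a ^ 3) ^ 2 ≤ (∑ a ∈ s, u a ^ 2) * ∑ a ∈ s, u a ^ 4 :=
    Finset.sum_sq_le_sum_mul_sum_of_sq_le_mul s (fun a _ => by positivity)
      (fun a _ => by positivity) fun a _ => le_of_eq (by ring)
  have n1 : 0 ≤ ∑ a ∈ s, u a := Finset.sum_nonneg hu
  have n2 : 0 ≤ ∑ a ∈ s, u a ^ 2 := Finset.sum_nonneg fun a _ => by positivity
  have n4 : 0 ≤ ∑ a ∈ s, u a ^ 4 := Finset.sum_nonneg fun a _ => by positivity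
  rcases n2.eq_or_lt with h0 | h0
  · rw [← h0, zero_pow (by norm_num)]; positivity
  refine le_of_mul_le_mul_left ?_ h0
  calc (∑ a ∈ s, u a ^ 2) * (∑ a ∈ s, u a ^ 2) ^ 3 = ((∑ a ∈ s, u a ^ 2) ^ 2) ^ 2 := by ring
    _ ≤ ((∑ a ∈ s, u a) * ∑ a ∈ s, u a ^ 3) ^ 2 := by gcongr
    _ = (∑ a ∈ s, u a) ^ 2 * (∑ a ∈ s, u a ^ 3) ^ 2 := by ring
    _ ≤ (∑ a ∈ s, u a) ^ 2 * ((∑ a ∈ s, u a ^ 2) * ∑ a ∈ s, u a ^ 4) := by gcongr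
    _ = _ := by ring

/-- Low-degree polynomials have comparable first and second moments. -/
lemma cubeMean_sq_le_cubeMean_abs_sq {U : Finset ι} {d : ℕ} {f : (ι → Bool) → ℝ}
    (hf : f ∈ polyLT U d) :
    cubeMean (f ^ 2) ≤ 9 ^ d * cubeMean (fun x => |f x|) ^ 2 := by
  have h4 := cubeMean_pow_four_le U d hf
  have hH : cubeMean (f ^ 2) ^ 3 ≤ cubeMean (fun x => |f x|) ^ 2 * cubeMean (f ^ 4) := by
    have h := sum_sq_pow_three_le Finset.univ (u := fun x => |f x|) fun x _ => abs_nonneg _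
    simp only [sq_abs, (show Even 4 by decide).pow_abs] at h
    simp only [cubeMean_apply, Pi.pow_apply]
    have h2 := mul_le_mul_of_nonneg_left h
      (pow_nonneg (inv_nonneg.2 (card_cube_pos (ι := ι)).le) 3)
    calc _ = _ := by ring
      _ ≤ _ := h2
      _ = _ := by ring
  have n2 : 0 ≤ cubeMean (f ^ 2) := cubeMean_nonneg fun x => by
    simp only [Pi.pow_apply]; positivity
  rcases n2.eq_or_lt with h0 | h0
  · rw [← h0]; positivity
  refine le_of_mul_le_mul_left ?_ (pow_pos h0 2)
  calc cubeMean (f ^ 2) ^ 2 * cubeMean (f ^ 2) = cubeMean (f ^ 2) ^ 3 := by ring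
    _ ≤ _ := hH
    _ ≤ cubeMean (fun x => |f x|) ^ 2 * (9 ^ d * cubeMean (f ^ 2) ^ 2) := by gcongr
    _ = _ := by ring

end Mean

section Fourier

variable {ι : Type*} [Fintype ι] [DecidableEq ι]

lemma eq_sum_cubeMean_mul_chi {U : Finset ι} {d : ℕ} {f : (ι → Bool) → ℝ}
    (hf : f ∈ polyLT U d) : f = ∑ S, cubeMean (f * chi S) • chi S := by
  refine polyLT_induction (p := fun f => f = ∑ S, cubeMean (f * chi S) • chi S) ?_ ?_ ?_ ?_ hf
  · intro S _ _
    simp [cubeMean_chi_mul_chi]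
  · simp
  · intro f g hf hg
    simp_rw [add_mul, map_add, add_smul, Finset.sum_add_distrib]
    rw [← hf, ← hg]
  · intro r f hf
    simp_rw [smul_mul_assoc, map_smul, smul_eq_mul, mul_smul, ← Finset.smul_sum]
    rw [← hf]

lemma cubeMean_mul_chi_eq_zero {U S : Finset ι} {d : ℕ} {f : (ι → Bool) → ℝ}
    (hf : f ∈ polyLT U d) (hS : S ⊆ U → d ≤ S.card) : cubeMean (f * chi S) = 0 := by
  refine polyLT_induction (p := fun f => cubeMean (f * chi S) = 0) ?_ ?_ ?_ ?_ hf
  · intro T hT hd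
    rw [cubeMean_chi_mul_chi, if_neg]
    rintro rfl
    exact absurd (hS hT) (by omega)
  · simp
  · intro f g hf hg; rw [add_mul, map_add, hf, hg, add_zero]
  · intro r f hf; rw [smul_mul_assoc, map_smul, hf, smul_zero]

lemma cubeMean_sq_eq_sum {U : Finset ι} {d : ℕ} {f : (ι → Bool) → ℝ} (hf : f ∈ polyLT U d) :
    cubeMean (f ^ 2) = ∑ S, cubeMean (f * chi S) ^ 2 := by
  have h : f ^ 2 = ∑ S, cubeMean (f * chi S) • (f * chi S) := by
    conv_lhs => rw [sq]; arg 2; rw [eq_sum_cubeMean_mul_chi hf]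
    simp [Finset.mul_sum]
  rw [h, map_sum]
  exact Finset.sum_congr rfl fun S _ => by rw [map_smul, smul_eq_mul, sq]

/-- The variables on which a function on the cube depends. -/
noncomputable def relevantVars (f : (ι → Bool) → ℝ) : Finset ι :=
  open Classical in {i | ∃ x, f (flipAt i x) ≠ f x}

lemma exists_coeff_ne_zero {U : Finset ι} {d : ℕ} {f : (ι → Bool) → ℝ} (hf : f ∈ polyLT U d)
    {i : ι} (hi : i ∈ relevantVars f) : ∃ S, i ∈ S ∧ cubeMean (f * chi S) ≠ 0 := by
  simp only [relevantVars, Finset.mem_filter, Finset.mem_univ, true_and] at hi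
  obtain ⟨x, hx⟩ := hi
  by_contra! h
  apply hx
  rw [eq_sum_cubeMean_mul_chi hf]
  simp only [Finset.sum_apply, Pi.smul_apply]
  refine Finset.sum_congr rfl fun S _ => ?_
  by_cases hS : i ∈ S
  · simp [h S hS]
  · rw [chi_flipAt hS]

/-- A polynomial of degree at most `d` whose coefficients are multiples of `γ` deviates from its
mean by an amount controlling the number of its relevant variables. -/
lemma card_relevantVars_mul_le {d : ℕ} {f : (ι → Bool) → ℝ} (hf : f ∈ polyLT univ (d + 1))
    {γ : ℝ} (hγ : 0 < γ) (hmult : ∀ S, ∃ z : ℤ, cubeMean (f * chi S) = z * γ) :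
    (relevantVars f).card * γ ^ 2 ≤
      d * 9 ^ (d + 1) * cubeMean (fun x => |f x - cubeMean f|) ^ 2 := by
  set g : (ι → Bool) → ℝ := f - cubeMean f • (1 : (ι → Bool) → ℝ) with hg
  have hgm : g ∈ polyLT univ (d + 1) :=
    Submodule.sub_mem _ hf (Submodule.smul_mem _ _ (one_mem_polyLT (by omega)))
  have hgx : (fun x => |f x - cubeMean f|) = fun x => |g x| := by ext x; simp [hg]
  have hcoef : ∀ S, cubeMean (g * chi S) = if S = ∅ then 0 else cubeMean (f * chi S) := by
    intro S
    rw [hg, sub_mul, map_sub, smul_mul_assoc, one_mul, map_smul, cubeMean_chi]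
    split_ifs with h
    · subst h; rw [chi_empty, mul_one]; simp
    · simp
  have key : (relevantVars f).card * γ ^ 2 ≤ d * cubeMean (g ^ 2) := by
    rw [cubeMean_sq_eq_sum hgm, Finset.mul_sum]
    calc ((relevantVars f).card : ℝ) * γ ^ 2 = ∑ i ∈ relevantVars f, γ ^ 2 := by simp
      _ ≤ ∑ i ∈ relevantVars f, ∑ S, if i ∈ S then cubeMean (f * chi S) ^ 2 else 0 := by
        refine Finset.sum_le_sum fun i hi => ?_
        obtain ⟨S, hiS, hS⟩ := exists_coeff_ne_zero hf hi
        refine le_trans ?_ (Finset.single_le_sum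
          (f := fun S => if i ∈ S then cubeMean (f * chi S) ^ 2 else 0)
          (fun S _ => by positivity) (Finset.mem_univ S))
        simp only [hiS, if_true]
        obtain ⟨z, hz⟩ := hmult S
        rw [hz, mul_pow]
        refine le_mul_of_one_le_left (by positivity) ?_
        have hz0 : z ≠ 0 := by rintro rfl; simp [hz] at hS
        have : 1 ≤ z ^ 2 := by have := sq_pos_of_ne_zero hz0; omega
        exact_mod_cast this
      _ ≤ ∑ i, ∑ S, if i ∈ S then cubeMean (f * chi S) ^ 2 else 0 :=
        Finset.sum_le_univ_sum_of_nonneg fun i => Finset.sum_nonneg fun S _ => by positivity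
      _ = ∑ S, (S.card : ℝ) * cubeMean (f * chi S) ^ 2 := by
        rw [Finset.sum_comm]
        refine Finset.sum_congr rfl fun S _ => ?_
        rw [← Finset.sum_filter]; simp
      _ ≤ ∑ S, (d : ℝ) * cubeMean (g * chi S) ^ 2 := by
        refine Finset.sum_le_sum fun S _ => ?_
        rw [hcoef]
        split_ifs with h
        · simp [h]
        · by_cases hS : S.card ≤ d
          · gcongr
          · rw [cubeMean_mul_chi_eq_zero hf fun _ => by omega]; simp
  rw [hgx]
  calc _ ≤ _ := key
    _ ≤ d * (9 ^ (d + 1) * cubeMean (fun x => |g x|) ^ 2) := by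
      gcongr; exact cubeMean_sq_le_cubeMean_abs_sq hgm
    _ = _ := by ring

lemma cubeMean_abs_sub_le {f : (ι → Bool) → ℝ} {M : ℝ} (hM : ∀ x, f x ≤ M) :
    cubeMean (fun x => |f x - cubeMean f|) ≤ 2 * (M - cubeMean f) := by
  have hm : cubeMean f ≤ M := by
    simpa [cubeMean_const] using cubeMean_mono hM
  calc _ ≤ cubeMean ((fun _ => 2 * M - cubeMean f) - f) := by
        refine cubeMean_mono fun x => ?_
        simp only [Pi.sub_apply]
        rw [abs_le]
        constructor <;> linarith [hM x]
    _ = _ := by rw [map_sub, cubeMean_const]; ring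

end Fourier

section Substitution

variable {ι κ : Type*}

/-- The substitution `x i = ± y (φ i)`, with signs given by `ε`. -/
def substCube (φ : ι → κ) (ε : ι → Bool) (y : κ → Bool) : ι → Bool := fun i => y (φ i) == ε i

lemma boolSign_beq (a b : Bool) : boolSign (a == b) = boolSign a * boolSign b := by
  cases a <;> cases b <;> simp [boolSign]

lemma exists_chi_substCube [DecidableEq ι] [DecidableEq κ] (φ : ι → κ) (ε : ι → Bool)
    (S : Finset ι) : ∃ T : Finset κ, T.card ≤ S.card ∧ ∃ z : ℤ,
      ∀ y, chi S (substCube φ ε y) = z * chi T y := by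
  induction S using Finset.induction_on with
  | empty => exact ⟨∅, le_rfl, 1, fun y => by simp [chi]⟩
  | insert i S hi ih =>
    obtain ⟨T, hT, z, hz⟩ := ih
    refine ⟨symmDiff T {φ i}, ?_, (if ε i then 1 else -1) * z, fun y => ?_⟩
    · rw [Finset.card_insert_of_notMem hi]
      calc (symmDiff T {φ i}).card ≤ (insert (φ i) T).card := Finset.card_le_card (by
            intro j; simp only [Finset.mem_symmDiff, Finset.mem_singleton, Finset.mem_insert]
            grind)
        _ ≤ _ := (Finset.card_insert_le _ _).trans (by omega)
    · rw [chi_insert hi, ← coord_mul_chi, Pi.mul_apply, Pi.mul_apply, hz]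
      simp only [coord, substCube, boolSign_beq]
      simp only [boolSign]
      push_cast
      ring

variable [Fintype ι] [DecidableEq ι] [Fintype κ] [DecidableEq κ]

lemma substCube_mem_polyLT {c : Finset ι → ℝ} {d : ℕ} (hc : ∀ S, d < S.card → c S = 0)
    (φ : ι → κ) (ε : ι → Bool) :
    (fun y => (∑ S, c S • chi S) (substCube φ ε y)) ∈ polyLT univ (d + 1) := by
  have : (fun y => (∑ S, c S • chi S) (substCube φ ε y))
      = ∑ S, fun y => c S * chi S (substCube φ ε y) := by
    ext y; simp
  rw [this]
  refine Submodule.sum_mem _ fun S _ => ?_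
  by_cases hS : d < S.card
  · simp only [hc S hS, zero_mul]
    exact Submodule.zero_mem _
  · obtain ⟨T, hT, z, hz⟩ := exists_chi_substCube φ ε S
    simp_rw [hz, ← mul_assoc]
    exact Submodule.smul_mem _ (c S * z) (chi_mem_polyLT (subset_univ T) (by omega))

lemma exists_coeff_substCube {c : Finset ι → ℝ} {γ : ℝ} (hc : ∀ S, ∃ z : ℤ, c S = z * γ)
    (φ : ι → κ) (ε : ι → Bool) (T : Finset κ) :
    ∃ z : ℤ, cubeMean ((fun y => (∑ S, c S • chi S) (substCube φ ε y)) * chi T) = z * γ := by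
  have h1 : (fun y => (∑ S, c S • chi S) (substCube φ ε y)) * chi T
      = ∑ S, (fun y => c S * chi S (substCube φ ε y)) * chi T := by
    ext y; simp [Finset.sum_mul]
  have h2 : ∀ S, ∃ z : ℤ, cubeMean ((fun y => c S * chi S (substCube φ ε y)) * chi T) = z * γ := by
    intro S
    obtain ⟨T', -, z, hz⟩ := exists_chi_substCube φ ε S
    obtain ⟨w, hw⟩ := hc S
    have h3 : (fun y => c S * chi S (substCube φ ε y)) * chi T
        = (c S * z) • (chi T' * chi T) := by
      ext y; simp [hz, mul_assoc]
    refine ⟨w * z * if T' = T then 1 else 0, ?_⟩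
    rw [h3, map_smul, cubeMean_chi_mul_chi, hw, smul_eq_mul]
    push_cast
    ring
  choose z hz using h2
  refine ⟨∑ S, z S, ?_⟩
  rw [h1, map_sum]
  simp [hz, Finset.sum_mul]

end Substitution

section Slice

variable {ι : Type*} [DecidableEq ι]

/-- The sum of the coordinate functions over `U`. -/
noncomputable def coordSum (U : Finset ι) : (ι → Bool) → ℝ := ∑ i ∈ U, coord i

omit [DecidableEq ι] in
lemma coordSum_apply (U : Finset ι) (x : ι → Bool) : coordSum U x = ∑ i ∈ U, boolSign (x i) := by
  simp [coordSum, coord]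

omit [DecidableEq ι] in
lemma sum_comp_perm_of_forall_mem {U : Finset ι} {ρ : Equiv.Perm ι} (hρ : ∀ i ∈ U, ρ i ∈ U)
    (g : ι → ℝ) : ∑ i ∈ U, g (ρ i) = ∑ i ∈ U, g i := by
  have hU : U.map ρ.toEmbedding = U := by
    refine Finset.eq_of_subset_of_card_le ?_ (by simp)
    intro i hi
    obtain ⟨j, hj, rfl⟩ := Finset.mem_map.1 hi
    exact hρ j hj
  conv_rhs => rw [← hU, Finset.sum_map]
  rfl

omit [DecidableEq ι] in
lemma coordSum_comp_perm {U : Finset ι} {ρ : Equiv.Perm ι} (hρ : ∀ i ∈ U, ρ i ∈ U)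
    (x : ι → Bool) : coordSum U (x ∘ ρ) = coordSum U x := by
  simp_rw [coordSum_apply]
  exact sum_comp_perm_of_forall_mem hρ fun i => boolSign (x i)

omit [DecidableEq ι] in
lemma exists_coordSum_eq_zero {U : Finset ι} (hU : Even U.card) :
    ∃ x : ι → Bool, coordSum U x = 0 := by
  classical
  obtain ⟨m, hm⟩ := hU
  obtain ⟨V, hV, hVm⟩ := Finset.exists_subset_card_eq (show m ≤ U.card by omega)
  refine ⟨fun i => decide (i ∈ V), ?_⟩
  rw [coordSum_apply, ← Finset.sum_sdiff hV,
    Finset.sum_congr rfl (g := fun _ => (-1 : ℝ)) (s₂ := U \ V),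
    Finset.sum_congr rfl (g := fun _ => (1 : ℝ)) (s₂ := V)]
  · rw [Finset.sum_const, Finset.sum_const, Finset.card_sdiff_of_subset hV, hVm, hm]
    simp
  · intro i hi; simp [boolSign, hi]
  · intro i hi; simp [boolSign, (Finset.mem_sdiff.1 hi).2]

lemma swap_mem {U : Finset ι} {i j : ι} (hi : i ∈ U) (hj : j ∈ U) :
    ∀ k ∈ U, Equiv.swap i j k ∈ U := by
  intro k hk
  rw [Equiv.swap_apply_def]
  split_ifs <;> assumption

lemma coord_mul_mem_polyLT {U : Finset ι} {i : ι} (hi : i ∈ U) {d : ℕ} {f : (ι → Bool) → ℝ}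
    (hf : f ∈ polyLT U d) : coord i * f ∈ polyLT U (d + 1) := by
  refine polyLT_induction (p := fun f => coord i * f ∈ polyLT U (d + 1)) ?_ ?_ ?_ ?_ hf
  · intro S hS hd
    rw [coord_mul_chi]
    have hsub : symmDiff S {i} ⊆ insert i S := by
      intro j; simp only [Finset.mem_symmDiff, Finset.mem_singleton, Finset.mem_insert]; grind
    refine chi_mem_polyLT (hsub.trans (Finset.insert_subset hi hS)) ?_
    have := Finset.card_le_card hsub
    have := Finset.card_insert_le i S
    omega
  · rw [mul_zero]; exact Submodule.zero_mem _
  · intro f g hf hg; rw [mul_add]; exact Submodule.add_mem _ hf hg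
  · intro r f hf; rw [mul_smul_comm]; exact Submodule.smul_mem _ r hf

/-- The difference of a polynomial and its image under a transposition is divisible by the
difference of the two variables. -/
lemma exists_sub_swap_eq {U : Finset ι} {i j : ι} (hi : i ∈ U) (hj : j ∈ U) (hij : i ≠ j)
    {d : ℕ} {f : (ι → Bool) → ℝ} (hf : f ∈ polyLT U (d + 1)) :
    ∃ g ∈ polyLT ((U.erase i).erase j) d, ∀ x : ι → Bool,
      f x - f (x ∘ Equiv.swap i j) = (coord i x - coord j x) * g x := by
  set V := (U.erase i).erase j with hV
  have hUV : insert j V = U.erase i := Finset.insert_erase (by simp [hj, hij.symm])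
  have hagree : ∀ x : ι → Bool, ∀ k ∈ V, (x ∘ Equiv.swap i j) k = x k := by
    intro x k hk
    simp only [hV, Finset.mem_erase] at hk
    simp [Equiv.swap_apply_of_ne_of_ne hk.2.1 hk.1]
  have ci : ∀ x : ι → Bool, coord i (x ∘ Equiv.swap i j) = coord j x := by
    intro x; simp [coord]
  have cj : ∀ x : ι → Bool, coord j (x ∘ Equiv.swap i j) = coord i x := by
    intro x; simp [coord]
  rw [← Finset.insert_erase hi] at hf
  obtain ⟨a, ha, b, hb, rfl⟩ := exists_eq_add_coord_mul hf
  rw [← hUV] at ha hb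
  obtain ⟨a₁, ha₁, a₂, ha₂, rfl⟩ := exists_eq_add_coord_mul ha
  have hb' : ∃ b₁ ∈ polyLT V d, ∃ b₂ ∈ polyLT V d, b = b₁ + coord j * b₂ := by
    cases d with
    | zero => exact ⟨0, Submodule.zero_mem _, 0, Submodule.zero_mem _, by simp [polyLT_zero hb]⟩
    | succ d =>
      obtain ⟨b₁, hb₁, b₂, hb₂, h⟩ := exists_eq_add_coord_mul hb
      exact ⟨b₁, hb₁, b₂, polyLT_mono (Finset.Subset.refl _) (by omega) hb₂, h⟩
  obtain ⟨b₁, hb₁, b₂, hb₂, rfl⟩ := hb'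
  refine ⟨b₁ - a₂, Submodule.sub_mem _ hb₁ ha₂, fun x => ?_⟩
  simp only [Pi.add_apply, Pi.mul_apply, Pi.sub_apply, ci, cj,
    apply_eq_of_mem_polyLT ha₁ (hagree x), apply_eq_of_mem_polyLT ha₂ (hagree x),
    apply_eq_of_mem_polyLT hb₁ (hagree x), apply_eq_of_mem_polyLT hb₂ (hagree x)]
  ring

/-- The action of permutations of the variables on functions on the cube. -/
def permAct (ρ : Equiv.Perm ι) : ((ι → Bool) → ℝ) →ₗ[ℝ] ((ι → Bool) → ℝ) :=
  LinearMap.funLeft ℝ ℝ fun x => x ∘ ρ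

omit [DecidableEq ι] in
lemma permAct_apply (ρ : Equiv.Perm ι) (f : (ι → Bool) → ℝ) (x : ι → Bool) :
    permAct ρ f x = f (x ∘ ρ) := rfl

omit [DecidableEq ι] in
lemma permAct_mul (ρ σ : Equiv.Perm ι) (f : (ι → Bool) → ℝ) :
    permAct (ρ * σ) f = permAct ρ (permAct σ f) := rfl

/-- The multiples of `coordSum U` by polynomials of degree less than `d`. -/
noncomputable def sumMultiples (U : Finset ι) (d : ℕ) : Submodule ℝ ((ι → Bool) → ℝ) :=
  (polyLT U d).map (LinearMap.mulLeft ℝ (coordSum U))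

omit [DecidableEq ι] in
lemma mem_sumMultiples {U : Finset ι} {d : ℕ} {f : (ι → Bool) → ℝ} :
    f ∈ sumMultiples U d ↔ ∃ h ∈ polyLT U d, coordSum U * h = f := by
  simp [sumMultiples]

omit [DecidableEq ι] in
lemma permAct_mem_sumMultiples {U : Finset ι} {d : ℕ} {f : (ι → Bool) → ℝ}
    (hf : f ∈ sumMultiples U d) {ρ : Equiv.Perm ι} (hρ : ∀ i ∈ U, ρ i ∈ U) :
    permAct ρ f ∈ sumMultiples U d := by
  obtain ⟨h, hh, rfl⟩ := mem_sumMultiples.1 hf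
  refine mem_sumMultiples.2 ⟨permAct ρ h, polyLT_comp_perm hh hρ, ?_⟩
  ext x
  simp [permAct_apply, coordSum_comp_perm hρ]

/-- The sum of the images of a function under all permutations of the variables in `A`. -/
noncomputable def symmetrize (A : Finset ι) : ((ι → Bool) → ℝ) →ₗ[ℝ] ((ι → Bool) → ℝ) :=
  ∑ ρ : Equiv.Perm A, permAct (Equiv.Perm.ofSubtype ρ)

lemma symmetrize_apply (A : Finset ι) (f : (ι → Bool) → ℝ) :
    symmetrize A f = ∑ ρ : Equiv.Perm A, permAct (Equiv.Perm.ofSubtype ρ) f := by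
  simp [symmetrize]

lemma ofSubtype_mem {A U : Finset ι} (hA : A ⊆ U) (ρ : Equiv.Perm A) :
    ∀ i ∈ U, Equiv.Perm.ofSubtype ρ i ∈ U := by
  intro i hi
  by_cases h : i ∈ A
  · rw [Equiv.Perm.ofSubtype_apply_of_mem ρ h]
    exact hA (ρ ⟨i, h⟩).2
  · rwa [Equiv.Perm.ofSubtype_apply_of_not_mem ρ h]

lemma symmetrize_permAct_swap {A : Finset ι} {i j : ι} (hi : i ∈ A) (hj : j ∈ A)
    (f : (ι → Bool) → ℝ) : symmetrize A (permAct (Equiv.swap i j) f) = symmetrize A f := by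
  rw [symmetrize_apply, symmetrize_apply]
  refine Fintype.sum_equiv (Equiv.mulRight (Equiv.swap ⟨i, hi⟩ ⟨j, hj⟩)) _ _ fun ρ => ?_
  rw [← permAct_mul, Equiv.coe_mulRight, map_mul, Equiv.Perm.ofSubtype_swap_eq]

lemma symmetrize_coordSum_mul {A U : Finset ι} (hA : A ⊆ U) (f : (ι → Bool) → ℝ) :
    symmetrize A (coordSum U * f) = coordSum U * symmetrize A f := by
  rw [symmetrize_apply, symmetrize_apply, Finset.mul_sum]
  refine Finset.sum_congr rfl fun ρ _ => ?_
  ext x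
  simp [permAct_apply, coordSum_comp_perm (ofSubtype_mem hA ρ)]

lemma symmetrize_mem_polyLT {A U : Finset ι} (hA : A ⊆ U) {d : ℕ} {f : (ι → Bool) → ℝ}
    (hf : f ∈ polyLT U d) : symmetrize A f ∈ polyLT U d := by
  rw [symmetrize_apply]
  exact Submodule.sum_mem _ fun ρ _ => polyLT_comp_perm hf (ofSubtype_mem hA ρ)

/-- Modulo multiples of `coordSum U`, a polynomial symmetric in the variables of `A` can be written
in terms of the other variables. -/
lemma symmetrize_chi_mem {A U : Finset ι} (hA : A ⊆ U) {d : ℕ} {S : Finset ι} (hS : S ⊆ U)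
    (hd : S.card < d + 1) :
    symmetrize A (chi S) ∈ polyLT (U \ A) (d + 1) ⊔ sumMultiples U d := by
  induction hk : (S ∩ A).card using Nat.strong_induction_on generalizing S with
  | _ k ih =>
    subst hk
    rcases (S ∩ A).eq_empty_or_nonempty with hSA | ⟨r, hr⟩
    · have hSU : S ⊆ U \ A := by
        intro i hi
        refine Finset.mem_sdiff.2 ⟨hS hi, fun hiA => ?_⟩
        have := Finset.mem_inter.2 ⟨hi, hiA⟩
        simp [hSA] at this
      refine Submodule.mem_sup_left ?_
      rw [symmetrize_apply]
      refine Submodule.sum_mem _ fun ρ _ => ?_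
      have : permAct (Equiv.Perm.ofSubtype ρ) (chi S) = chi S := by
        ext x
        refine apply_eq_of_mem_polyLT (chi_mem_polyLT hSU hd) fun i hi => ?_
        simp [Equiv.Perm.ofSubtype_apply_of_not_mem ρ (Finset.mem_sdiff.1 hi).2]
      rw [this]
      exact chi_mem_polyLT hSU hd
    · obtain ⟨hrS, hrA⟩ := Finset.mem_inter.1 hr
      set S' := S.erase r with hS'
      have hcard : S'.card + 1 = S.card := Finset.card_erase_add_one hrS
      have hS'U : S' ⊆ U := (Finset.erase_subset _ _).trans hS
      have hexp : coordSum U * chi S' = ∑ u ∈ U, chi (symmDiff S' {u}) := by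
        simp [coordSum, Finset.sum_mul, coord_mul_chi]
      have hI : symmetrize A (coordSum U * chi S') ∈ sumMultiples U d := by
        rw [symmetrize_coordSum_mul hA]
        exact mem_sumMultiples.2 ⟨_, symmetrize_mem_polyLT hA
          (chi_mem_polyLT hS'U (by omega)), rfl⟩
      have hAS : A \ S' ⊆ U := Finset.sdiff_subset.trans hA
      rw [hexp, map_sum, ← Finset.sum_sdiff hAS] at hI
      have h1 : ∀ u ∈ A \ S', symmetrize A (chi (symmDiff S' {u})) = symmetrize A (chi S) := by
        intro u hu
        obtain ⟨huA, huS⟩ := Finset.mem_sdiff.1 hu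
        rw [← symmetrize_permAct_swap huA hrA (chi S)]
        congr 1
        ext x
        rw [permAct_apply, chi_comp_perm]
        congr 1
        ext j
        simp only [Finset.mem_symmDiff, Finset.mem_singleton, Finset.mem_map,
          Equiv.coe_toEmbedding]
        constructor
        · rintro (⟨hj, hju⟩ | ⟨rfl, hj⟩)
          · have hjr : j ≠ r := Finset.ne_of_mem_erase hj
            exact ⟨j, Finset.mem_of_mem_erase hj, Equiv.swap_apply_of_ne_of_ne hju hjr⟩
          · exact ⟨r, hrS, by simp⟩
        · rintro ⟨a, ha, rfl⟩
          by_cases har : a = r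
          · subst har; right; simpa using huS
          · have haS' : a ∈ S' := Finset.mem_erase.2 ⟨har, ha⟩
            have hau : a ≠ u := by rintro rfl; exact huS haS'
            left
            rw [Equiv.swap_apply_of_ne_of_ne hau har]
            exact ⟨haS', hau⟩
      have h2 : ∀ u ∈ U \ (A \ S'), symmetrize A (chi (symmDiff S' {u})) ∈
          polyLT (U \ A) (d + 1) ⊔ sumMultiples U d := by
        intro u hu
        have hsub : symmDiff S' {u} ⊆ insert u S' := by
          intro j; simp only [Finset.mem_symmDiff, Finset.mem_singleton, Finset.mem_insert]
          grind
        refine ih _ ?_ (hsub.trans (Finset.insert_subset (Finset.mem_sdiff.1 hu).1 hS'U)) ?_ rfl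
        · refine Finset.card_lt_card ⟨?_, fun h => ?_⟩
          · intro j hj
            simp only [Finset.mem_symmDiff, Finset.mem_singleton, Finset.mem_inter,
              Finset.mem_sdiff, hS', Finset.mem_erase] at hj hu ⊢
            grind
          · have := h hr
            simp only [Finset.mem_symmDiff, Finset.mem_singleton, Finset.mem_inter,
              Finset.mem_sdiff, hS', Finset.mem_erase] at this hu
            grind
        · have := Finset.card_le_card hsub
          have := Finset.card_insert_le u S'
          omega
      have h3 := Submodule.sum_mem _ h2
      rw [Finset.sum_congr rfl h1, Finset.sum_const, ← Nat.cast_smul_eq_nsmul ℝ] at hI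
      have h4 := Submodule.sub_mem _ (Submodule.mem_sup_right hI) h3
      rw [add_sub_cancel_left] at h4
      have hpos : ((A \ S').card : ℝ) ≠ 0 := by
        have : 0 < (A \ S').card := Finset.card_pos.2 ⟨r, by simp [hrA, hS']⟩
        positivity
      exact (Submodule.smul_mem_iff _ hpos).1 h4

/-- A polynomial which on the slice `coordSum U = 0` is symmetric in the variables of `A` agrees,
modulo a multiple of `coordSum U`, with a polynomial in the remaining variables. -/
theorem mem_sup_sumMultiples {U A : Finset ι} (hA : A ⊆ U) (hU : Even U.card) {d : ℕ}
    {f : (ι → Bool) → ℝ} (hf : f ∈ polyLT U (d + 1))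
    (hsymm : ∀ i ∈ A, ∀ j ∈ A, ∀ x, coordSum U x = 0 → f (x ∘ Equiv.swap i j) = f x) :
    f ∈ polyLT (U \ A) (d + 1) ⊔ sumMultiples U d := by
  induction d generalizing U A f with
  | zero =>
    refine Submodule.mem_sup_left ?_
    have : f = f (fun _ => true) • (1 : (ι → Bool) → ℝ) := by
      ext x; simpa using polyLT_one hf x _
    rw [this]
    exact Submodule.smul_mem _ _ (one_mem_polyLT (by omega))
  | succ d ih =>
    have hswap : ∀ i ∈ A, ∀ j ∈ A, permAct (Equiv.swap i j) f - f ∈ sumMultiples U (d + 1) := by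
      intro i hi j hj
      by_cases hij : i = j
      · subst hij
        have : permAct (Equiv.swap i i) f - f = 0 := by
          ext x; simp [permAct_apply]
        rw [this]; exact Submodule.zero_mem _
      obtain ⟨g, hg, hfg⟩ := exists_sub_swap_eq (hA hi) (hA hj) hij hf
      set V := (U.erase i).erase j with hV
      have hjU : j ∈ U.erase i := by simp [hA hj, Ne.symm hij]
      have hVcard : V.card + 2 = U.card := by
        have h1 := Finset.card_erase_add_one (hA hi)
        have h2 : V.card + 1 = _ := Finset.card_erase_add_one hjU
        omega
      have hVeven : Even V.card := by
        rw [← hVcard] at hU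
        simpa [Nat.even_add] using hU
      have hsum : coordSum U = coord i + (coord j + coordSum V) := by
        rw [coordSum, ← Finset.add_sum_erase U _ (hA hi), ← Finset.add_sum_erase _ _ hjU]
        rfl
      have hVU : V ⊆ U := (Finset.erase_subset _ _).trans (Finset.erase_subset _ _)
      have hzero : ∀ x, coordSum V x = 0 → g x = 0 := by
        intro x hx
        set x' := Function.update (Function.update x i true) j false with hx'
        have hagree : ∀ k ∈ V, x' k = x k := by
          intro k hk
          simp only [hV, Finset.mem_erase] at hk
          simp [hx', hk.1, hk.2.1]
        have hi' : coord i x' = 1 := by simp [coord, hx', hij, boolSign]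
        have hj' : coord j x' = -1 := by simp [coord, hx', boolSign]
        have hx'0 : coordSum U x' = 0 := by
          rw [hsum, Pi.add_apply, Pi.add_apply, hi', hj', coordSum_apply,
            Finset.sum_congr rfl fun k hk => by rw [hagree k hk], ← coordSum_apply, hx]
          ring
        have h1 := hfg x'
        rw [hsymm i hi j hj x' hx'0, hi', hj', sub_self,
          apply_eq_of_mem_polyLT hg hagree] at h1
        linarith
      have hgV := ih (Finset.Subset.refl V) hVeven hg fun k hk l hl x hx => by
        rw [hzero x hx, hzero _ (by rwa [coordSum_comp_perm (swap_mem hk hl)])]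
      obtain ⟨g₀, hg₀, g₁, hg₁, rfl⟩ := Submodule.mem_sup.1 hgV
      obtain ⟨h, hh, rfl⟩ := mem_sumMultiples.1 hg₁
      have hg₀0 : g₀ = 0 := by
        obtain ⟨x₀, hx₀⟩ := exists_coordSum_eq_zero hVeven
        have h0 := hzero x₀ hx₀
        rw [Pi.add_apply, Pi.mul_apply, hx₀, zero_mul, add_zero] at h0
        ext x
        rw [apply_eq_of_mem_polyLT hg₀ (y := x₀) (by simp), h0]
        rfl
      refine mem_sumMultiples.2 ⟨coord j * h - coord i * h, Submodule.sub_mem _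
        (coord_mul_mem_polyLT (hA hj) (polyLT_mono hVU le_rfl hh))
        (coord_mul_mem_polyLT (hA hi) (polyLT_mono hVU le_rfl hh)), ?_⟩
      ext x
      have h1 := hfg x
      have hci := congrFun (coord_mul_self i) x
      have hcj := congrFun (coord_mul_self j) x
      rw [hg₀0, zero_add] at h1
      simp only [Pi.mul_apply, Pi.sub_apply, Pi.add_apply, Pi.one_apply, hsum,
        permAct_apply] at h1 hci hcj ⊢
      linear_combination h1 + h x * hcj - h x * hci
    have hperm : ∀ ρ : Equiv.Perm A,
        permAct (Equiv.Perm.ofSubtype ρ) f - f ∈ sumMultiples U (d + 1) := by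
      intro ρ
      induction ρ using Equiv.Perm.swap_induction_on with
      | one =>
        have : permAct (Equiv.Perm.ofSubtype (1 : Equiv.Perm A)) f - f = 0 := by
          ext x; simp [permAct_apply]
        rw [this]; exact Submodule.zero_mem _
      | swap_mul σ i j hij hσ =>
        rw [map_mul, permAct_mul, Equiv.Perm.ofSubtype_swap_eq]
        have h1 := permAct_mem_sumMultiples hσ (swap_mem (hA i.2) (hA j.2))
        have h2 := Submodule.add_mem _ h1 (hswap i i.2 j j.2)
        rwa [map_sub, sub_add_sub_cancel] at h2
    have hL : symmetrize A f ∈ polyLT (U \ A) (d + 1 + 1) ⊔ sumMultiples U (d + 1) := by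
      refine polyLT_induction
        (p := fun f => symmetrize A f ∈ polyLT (U \ A) (d + 1 + 1) ⊔ sumMultiples U (d + 1))
        ?_ ?_ ?_ ?_ hf
      · exact fun S hS hd => symmetrize_chi_mem hA hS hd
      · rw [map_zero]; exact Submodule.zero_mem _
      · intro f g hf hg; rw [map_add]; exact Submodule.add_mem _ hf hg
      · intro r f hf; rw [map_smul]; exact Submodule.smul_mem _ r hf
    have hD : symmetrize A f - (Fintype.card (Equiv.Perm A) : ℝ) • f ∈ sumMultiples U (d + 1) := by
      have : symmetrize A f - (Fintype.card (Equiv.Perm A) : ℝ) • f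
          = ∑ ρ : Equiv.Perm A, (permAct (Equiv.Perm.ofSubtype ρ) f - f) := by
        rw [Finset.sum_sub_distrib, ← symmetrize_apply, Finset.sum_const, Finset.card_univ,
          Nat.cast_smul_eq_nsmul]
      rw [this]
      exact Submodule.sum_mem _ fun ρ _ => hperm ρ
    have h5 := Submodule.sub_mem _ hL (Submodule.mem_sup_right hD)
    rw [sub_sub_cancel] at h5
    exact (Submodule.smul_mem_iff _ (by
      have : 0 < Fintype.card (Equiv.Perm A) := Fintype.card_pos
      positivity)).1 h5

end Slice

section AntiConcentration

variable {ι : Type*} [Fintype ι] [DecidableEq ι]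

/-- The points of the cube that agree with `z` outside `U` and are balanced on `U`. -/
noncomputable def balSlice (U : Finset ι) (z : ι → Bool) : Finset (ι → Bool) :=
  open Classical in {x | (∀ i ∉ U, x i = z i) ∧ coordSum U x = 0}

lemma mem_balSlice {U : Finset ι} {z x : ι → Bool} :
    x ∈ balSlice U z ↔ (∀ i ∉ U, x i = z i) ∧ coordSum U x = 0 := by
  simp [balSlice]

lemma comp_swap_mem_balSlice {U : Finset ι} {z x : ι → Bool} {i j : ι} (hi : i ∈ U) (hj : j ∈ U)
    (hx : x ∈ balSlice U z) : x ∘ Equiv.swap i j ∈ balSlice U z := by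
  rw [mem_balSlice] at hx ⊢
  refine ⟨fun k hk => ?_, by rw [coordSum_comp_perm (swap_mem hi hj), hx.2]⟩
  rw [Function.comp_apply, Equiv.swap_apply_of_ne_of_ne (by rintro rfl; exact hk hi)
    (by rintro rfl; exact hk hj)]
  exact hx.1 k hk

omit [Fintype ι] in
lemma comp_swap_comp_swap (x : ι → Bool) (i j : ι) :
    (x ∘ Equiv.swap i j) ∘ Equiv.swap i j = x := by
  ext k; simp

omit [Fintype ι] [DecidableEq ι] in
lemma two_mul_card_filter_ne {U : Finset ι} {x : ι → Bool} (hx : coordSum U x = 0) (i : ι) :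
    2 * #{j ∈ U | x i ≠ x j} = #U := by
  have h : ∑ j ∈ U, boolSign (x i) * boolSign (x j) = 0 := by
    rw [← Finset.mul_sum, ← coordSum_apply, hx, mul_zero]
  have h2 : ∀ j ∈ U, boolSign (x i) * boolSign (x j) =
      1 - 2 * if x i ≠ x j then (1 : ℝ) else 0 := by
    intro j _
    cases x i <;> cases x j <;> norm_num [boolSign]
  rw [Finset.sum_congr rfl h2, Finset.sum_sub_distrib, ← Finset.mul_sum, Finset.sum_boole] at h
  simp only [Finset.sum_const, nsmul_eq_mul, mul_one] at h
  have : (2 * #{j ∈ U | x i ≠ x j} : ℝ) = #U := by linarith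
  exact_mod_cast this

lemma card_balSlice_le_four_mul {U : Finset ι} (z : ι → Bool) {i j : ι} (hi : i ∈ U) (hj : j ∈ U)
    (hij : i ≠ j) : #(balSlice U z) ≤ 4 * #{x ∈ balSlice U z | x i = true ∧ x j = false} := by
  have hD : ∀ k ∈ U.erase i, #{x ∈ balSlice U z | x i ≠ x k} = #{x ∈ balSlice U z | x i ≠ x j} := by
    intro k hk
    obtain ⟨hki, hkU⟩ := Finset.mem_erase.1 hk
    refine Finset.card_bij' (fun x _ => x ∘ Equiv.swap j k) (fun x _ => x ∘ Equiv.swap j k)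
      ?_ ?_ ?_ ?_
    · intro x hx
      simp only [Finset.mem_filter] at hx ⊢
      exact ⟨comp_swap_mem_balSlice hj hkU hx.1, by
        simpa [Equiv.swap_apply_of_ne_of_ne hij hki.symm] using hx.2⟩
    · intro x hx
      simp only [Finset.mem_filter] at hx ⊢
      exact ⟨comp_swap_mem_balSlice hj hkU hx.1, by
        simpa [Equiv.swap_apply_of_ne_of_ne hij hki.symm] using hx.2⟩
    · intro x _; exact comp_swap_comp_swap x j k
    · intro x _; exact comp_swap_comp_swap x j k
  have h1 : 2 * ((#U - 1) * #{x ∈ balSlice U z | x i ≠ x j}) = #(balSlice U z) * #U := by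
    have hsum := Finset.sum_card_bipartiteAbove_eq_sum_card_bipartiteBelow
      (s := balSlice U z) (t := U.erase i) (fun x k => x i ≠ x k)
    simp only [Finset.bipartiteAbove, Finset.bipartiteBelow] at hsum
    rw [Finset.sum_congr rfl hD, Finset.sum_const, Finset.card_erase_of_mem hi, smul_eq_mul] at hsum
    rw [← hsum, Finset.mul_sum, Finset.card_eq_sum_ones, Finset.sum_mul]
    refine Finset.sum_congr rfl fun x hx => ?_
    rw [one_mul, ← two_mul_card_filter_ne (mem_balSlice.1 hx).2 i]
    congr 2
    ext k
    simp only [Finset.mem_filter, Finset.mem_erase]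
    grind
  have h2 : #{x ∈ balSlice U z | x i ≠ x j} =
      2 * #{x ∈ balSlice U z | x i = true ∧ x j = false} := by
    have hsw : #{x ∈ balSlice U z | x i = false ∧ x j = true}
        = #{x ∈ balSlice U z | x i = true ∧ x j = false} := by
      refine Finset.card_bij' (fun x _ => x ∘ Equiv.swap i j) (fun x _ => x ∘ Equiv.swap i j)
        ?_ ?_ ?_ ?_
      · intro x hx
        simp only [Finset.mem_filter] at hx ⊢
        exact ⟨comp_swap_mem_balSlice hi hj hx.1, by simpa using hx.2.symm⟩
      · intro x hx
        simp only [Finset.mem_filter] at hx ⊢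
        exact ⟨comp_swap_mem_balSlice hi hj hx.1, by simpa using hx.2.symm⟩
      · intro x _; exact comp_swap_comp_swap x i j
      · intro x _; exact comp_swap_comp_swap x i j
    rw [two_mul]
    nth_rewrite 2 [← hsw]
    rw [← Finset.card_union_of_disjoint]
    · congr 1
      ext x
      simp only [Finset.mem_filter, Finset.mem_union]
      cases x i <;> cases x j <;> simp
    · rw [Finset.disjoint_filter]
      intro x _ h h'
      simp [h.1] at h'
  have hpos : 0 < #U := Finset.card_pos.2 ⟨i, hi⟩
  have h3 : #(balSlice U z) * #U ≤ (2 * #{x ∈ balSlice U z | x i ≠ x j}) * #U := by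
    rw [← h1]
    calc _ = (2 * #{x ∈ balSlice U z | x i ≠ x j}) * (#U - 1) := by ring
      _ ≤ _ := Nat.mul_le_mul_left _ (Nat.sub_le _ _)
  have := Nat.le_of_mul_le_mul_right h3 hpos
  omega

lemma apply_eq_of_swap_invariant {U : Finset ι} {z : ι → Bool} {f : (ι → Bool) → ℝ}
    (hf : ∀ i ∈ U, ∀ j ∈ U, ∀ x ∈ balSlice U z, f (x ∘ Equiv.swap i j) = f x)
    {x y : ι → Bool} (hx : x ∈ balSlice U z) (hy : y ∈ balSlice U z) : f x = f y := by
  induction hk : #{i | x i ≠ y i} using Nat.strong_induction_on generalizing x with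
  | _ k ih =>
    subst hk
    by_cases hxy : x = y
    · rw [hxy]
    have hout : ∀ i ∉ U, x i = y i := fun i hi => by
      rw [(mem_balSlice.1 hx).1 i hi, (mem_balSlice.1 hy).1 i hi]
    have key : ∀ u v : ι → Bool, (∀ i ∉ U, u i = v i) → coordSum U u = 0 → coordSum U v = 0 →
        u ≠ v → ∃ i ∈ U, u i = true ∧ v i = false := by
      intro u v hout hu hv huv
      by_contra! hc
      apply huv
      have hle : ∀ i ∈ U, boolSign (u i) ≤ boolSign (v i) := by
        intro i hi
        have := hc i hi
        revert this
        cases u i <;> cases v i <;> norm_num [boolSign]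
      rw [coordSum_apply] at hu hv
      have heq := (Finset.sum_eq_sum_iff_of_le hle).1 (hu.trans hv.symm)
      ext i
      by_cases hi : i ∈ U
      · have := heq i hi
        revert this
        cases u i <;> cases v i <;> norm_num [boolSign]
      · rw [hout i hi]
    obtain ⟨i, hiU, hxi, hyi⟩ := key x y hout (mem_balSlice.1 hx).2 (mem_balSlice.1 hy).2 hxy
    obtain ⟨j, hjU, hyj, hxj⟩ := key y x (fun i hi => (hout i hi).symm) (mem_balSlice.1 hy).2
      (mem_balSlice.1 hx).2 (Ne.symm hxy)
    rw [← hf i hiU j hjU x hx]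
    refine ih _ ?_ (comp_swap_mem_balSlice hiU hjU hx) rfl
    refine Finset.card_lt_card ⟨fun k hk => ?_, fun h => ?_⟩
    · simp only [Finset.mem_filter, Finset.mem_univ, true_and, Function.comp_apply] at hk ⊢
      intro hxk
      by_cases hki : k = i
      · subst hki; simp [hxi, hyi] at hxk
      by_cases hkj : k = j
      · subst hkj; simp [hxj, hyj] at hxk
      · rw [Equiv.swap_apply_of_ne_of_ne hki hkj] at hk
        exact hk hxk
    · have := @h i (by simp [hxi, hyi])
      simp [hxj, hyi] at this

/-- If a polynomial of low degree is not invariant under a transposition on a slice, this is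
witnessed by a constant proportion of the points of the slice. -/
lemma card_balSlice_le_card_swap_ne {d : ℕ}
    (hd : ∀ (V : Finset ι) (z : ι → Bool) (g : (ι → Bool) → ℝ), g ∈ polyLT V (d + 1) →
      (∃ x ∈ balSlice V z, g x ≠ 0) → #(balSlice V z) ≤ 4 ^ d * #{x ∈ balSlice V z | g x ≠ 0})
    {U : Finset ι} {z : ι → Bool} {f : (ι → Bool) → ℝ} (hf : f ∈ polyLT U (d + 1 + 1))
    {i j : ι} (hi : i ∈ U) (hj : j ∈ U) (h : ∃ x ∈ balSlice U z, f (x ∘ Equiv.swap i j) ≠ f x) :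
    #(balSlice U z) ≤ 4 ^ (d + 1) *
      #{x ∈ balSlice U z | x i = true ∧ x j = false ∧ f (x ∘ Equiv.swap i j) ≠ f x} := by
  have hij : i ≠ j := by
    rintro rfl
    obtain ⟨x, -, hx⟩ := h
    simp at hx
  obtain ⟨x, hx, hxi, hxj, hfx⟩ : ∃ x ∈ balSlice U z, x i = true ∧ x j = false ∧
      f (x ∘ Equiv.swap i j) ≠ f x := by
    obtain ⟨x, hx, hfx⟩ := h
    rcases hxi : x i with _ | _ <;> rcases hxj : x j with _ | _
    · exfalso; apply hfx; congr 1
      ext k; by_cases hki : k = i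
      · subst hki; simp [hxi, hxj]
      by_cases hkj : k = j
      · subst hkj; simp [hxi, hxj]
      simp [Equiv.swap_apply_of_ne_of_ne hki hkj]
    · exact ⟨x ∘ Equiv.swap i j, comp_swap_mem_balSlice hi hj hx, by simp [hxj], by simp [hxi],
        by rw [comp_swap_comp_swap]; exact hfx.symm⟩
    · exact ⟨x, hx, hxi, hxj, hfx⟩
    · exfalso; apply hfx; congr 1
      ext k; by_cases hki : k = i
      · subst hki; simp [hxi, hxj]
      by_cases hkj : k = j
      · subst hkj; simp [hxi, hxj]
      simp [Equiv.swap_apply_of_ne_of_ne hki hkj]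
  obtain ⟨g, hg, hfg⟩ := exists_sub_swap_eq hi hj hij hf
  set V := (U.erase i).erase j with hV
  have hjU : j ∈ U.erase i := by simp [hj, hij.symm]
  have hsum : coordSum U = coord i + (coord j + coordSum V) := by
    rw [coordSum, ← Finset.add_sum_erase U _ hi, ← Finset.add_sum_erase _ _ hjU]
    rfl
  have hslice : {y ∈ balSlice U z | y i = true ∧ y j = false} = balSlice V x := by
    have hsum' : ∀ y : ι → Bool, y i = true → y j = false → coordSum U y = coordSum V y := by
      intro y hyi hyj
      simp [hsum, coord, hyi, hyj, boolSign]
    ext y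
    rw [Finset.mem_filter, mem_balSlice, mem_balSlice]
    constructor
    · rintro ⟨⟨h1, h2⟩, hyi, hyj⟩
      refine ⟨fun k hk => ?_, by rw [← hsum' y hyi hyj, h2]⟩
      by_cases hki : k = i
      · rw [hki, hyi, hxi]
      by_cases hkj : k = j
      · rw [hkj, hyj, hxj]
      have hkU : k ∉ U := fun hkU => hk (by simp [hV, hki, hkj, hkU])
      rw [h1 k hkU, (mem_balSlice.1 hx).1 k hkU]
    · rintro ⟨h1, h2⟩
      have hyi : y i = true := by rw [h1 i (by simp [hV]), hxi]
      have hyj : y j = false := by rw [h1 j (by simp [hV]), hxj]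
      refine ⟨⟨fun k hk => ?_, by rw [hsum' y hyi hyj, h2]⟩, hyi, hyj⟩
      rw [h1 k (by simp [hV, hk]), (mem_balSlice.1 hx).1 k hk]
  have hgne : ∀ y : ι → Bool, y i = true → y j = false →
      (g y ≠ 0 ↔ f (y ∘ Equiv.swap i j) ≠ f y) := by
    intro y hyi hyj
    have := hfg y
    simp only [coord, hyi, hyj, boolSign, if_true, Bool.false_eq_true, if_false] at this
    rw [not_iff_not]
    constructor <;> intro h <;> linarith
  have h1 := hd V x g hg ⟨x, by rw [← hslice]; simp [hx, hxi, hxj], (hgne x hxi hxj).2 hfx⟩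
  calc #(balSlice U z) ≤ 4 * #{x ∈ balSlice U z | x i = true ∧ x j = false} :=
        card_balSlice_le_four_mul z hi hj hij
    _ = 4 * #(balSlice V x) := by rw [hslice]
    _ ≤ 4 * (4 ^ d * #{x ∈ balSlice V x | g x ≠ 0}) := Nat.mul_le_mul_left _ h1
    _ = 4 ^ (d + 1) * #{x ∈ balSlice V x | g x ≠ 0} := by ring
    _ = _ := by
      congr 2
      ext y
      rw [← hslice, Finset.mem_filter, Finset.mem_filter, Finset.mem_filter]
      constructor
      · rintro ⟨⟨h1, h2, h3⟩, h4⟩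
        exact ⟨h1, h2, h3, (hgne y h2 h3).1 h4⟩
      · rintro ⟨h1, h2, h3, h4⟩
        exact ⟨⟨h1, h2, h3⟩, (hgne y h2 h3).2 h4⟩

/-- A polynomial of low degree which does not vanish on a slice is nonzero on a constant proportion
of the slice. -/
theorem card_balSlice_le_card_ne_zero (d : ℕ) (U : Finset ι) (z : ι → Bool) (f : (ι → Bool) → ℝ)
    (hf : f ∈ polyLT U (d + 1)) (h : ∃ x ∈ balSlice U z, f x ≠ 0) :
    #(balSlice U z) ≤ 4 ^ d * #{x ∈ balSlice U z | f x ≠ 0} := by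
  have hconst : (∀ x ∈ balSlice U z, ∀ y ∈ balSlice U z, f x = f y) →
      #(balSlice U z) ≤ #{x ∈ balSlice U z | f x ≠ 0} := by
    intro hc
    obtain ⟨x₀, hx₀, hfx₀⟩ := h
    rw [Finset.filter_true_of_mem fun x hx => by rwa [hc x hx x₀ hx₀]]
  induction d generalizing U z f with
  | zero =>
    simpa using hconst fun x _ y _ => polyLT_one hf x y
  | succ d ih =>
    by_cases hinv : ∀ i ∈ U, ∀ j ∈ U, ∀ x ∈ balSlice U z, f (x ∘ Equiv.swap i j) = f x
    · refine (hconst fun x hx y hy => apply_eq_of_swap_invariant hinv hx hy).trans ?_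
      exact Nat.le_mul_of_pos_left _ (by positivity)
    push Not at hinv
    obtain ⟨i, hi, j, hj, hx⟩ := hinv
    have ih' : ∀ (V : Finset ι) (z : ι → Bool) (g : (ι → Bool) → ℝ), g ∈ polyLT V (d + 1) →
        (∃ x ∈ balSlice V z, g x ≠ 0) →
          #(balSlice V z) ≤ 4 ^ d * #{x ∈ balSlice V z | g x ≠ 0} := by
      intro V z g hg hx
      refine ih V z g hg hx fun hc => ?_
      obtain ⟨x₀, hx₀, hfx₀⟩ := hx
      rw [Finset.filter_true_of_mem fun x hx => by rwa [hc x hx x₀ hx₀]]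
    refine (card_balSlice_le_card_swap_ne ih' hf hi hj hx).trans (Nat.mul_le_mul_left _ ?_)
    refine Finset.card_le_card_of_injOn (fun y => if f y ≠ 0 then y else y ∘ Equiv.swap i j)
      ?_ ?_
    · intro y hy
      simp only [Finset.coe_filter, Set.mem_ofPred_eq] at hy ⊢
      split_ifs with h0
      · exact ⟨hy.1, h0⟩
      · refine ⟨comp_swap_mem_balSlice hi hj hy.1, fun h1 => hy.2.2.2 ?_⟩
        rw [h1, not_not.1 h0]
    · intro y hy w hw hyw
      simp only [Finset.coe_filter, Set.mem_ofPred_eq] at hy hw hyw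
      split_ifs at hyw with h1 h2 h2
      · exact hyw
      · have := congrFun hyw i
        simp [hy.2.1, hw.2.2.1] at this
      · have := congrFun hyw i
        simp [hw.2.1, hy.2.2.1] at this
      · rw [← comp_swap_comp_swap y i j, hyw, comp_swap_comp_swap]

end AntiConcentration

section Pairing

/-- A map into `s` all of whose fibres over `s` are exchanged by permutations of the domain pushes
the uniform distribution forward to the uniform distribution on `s`. -/
lemma card_mul_sum_comp_eq {Ω T : Type*} [Fintype Ω] {φ : Ω → T} {s : Finset T}
    (hs : ∀ ω, φ ω ∈ s)
    (hφ : ∀ t ∈ s, ∀ t' ∈ s, ∃ ρ : Equiv.Perm Ω, ∀ ω, φ ω = t → φ (ρ ω) = t') (F : T → ℝ) :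
    #s * ∑ ω, F (φ ω) = Fintype.card Ω * ∑ t ∈ s, F t := by
  classical
  rcases s.eq_empty_or_nonempty with rfl | ⟨t₀, ht₀⟩
  · have : IsEmpty Ω := ⟨fun ω => by simpa using hs ω⟩
    simp
  have hle : ∀ t ∈ s, ∀ t' ∈ s, #{ω | φ ω = t} ≤ #{ω | φ ω = t'} := by
    intro t ht t' ht'
    obtain ⟨ρ, hρ⟩ := hφ t ht t' ht'
    exact Finset.card_le_card_of_injOn ρ (fun ω hω => by simpa using hρ ω (by simpa using hω))
      ρ.injective.injOn
  have heq : ∀ t ∈ s, #{ω | φ ω = t} = #{ω | φ ω = t₀} := fun t ht =>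
    le_antisymm (hle t ht t₀ ht₀) (hle t₀ ht₀ t ht)
  have hcard : Fintype.card Ω = #s * #{ω | φ ω = t₀} := by
    rw [← Finset.card_univ, Finset.card_eq_sum_card_fiberwise (f := φ) (t := s) (fun ω _ => hs ω),
      Finset.sum_congr rfl heq, Finset.sum_const, smul_eq_mul]
  have hsum : ∑ ω, F (φ ω) = #{ω | φ ω = t₀} * ∑ t ∈ s, F t := by
    rw [← Finset.sum_fiberwise_of_maps_to (g := φ) (t := s) (fun ω _ => hs ω), Finset.mul_sum]
    refine Finset.sum_congr rfl fun t ht => ?_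
    rw [Finset.sum_congr rfl (g := fun _ => F t) (fun ω hω => by rw [(Finset.mem_filter.1 hω).2]),
      Finset.sum_const, heq t ht, nsmul_eq_mul]
  rw [hsum, hcard]
  push_cast
  ring

lemma card_mul_sum_embedding_eq {α ι : Type*} [Fintype α] [Fintype ι] [DecidableEq α]
    [DecidableEq ι] {r : ℕ} (e : Fin r ↪ α) (F : (Fin r ↪ ι) → ℝ) :
    (Fintype.card ι).descFactorial r * ∑ π : α ≃ ι, F (e.trans π.toEmbedding)
      = Fintype.card (α ≃ ι) * ∑ e', F e' := by
  have h := card_mul_sum_comp_eq (Ω := α ≃ ι) (φ := fun π => e.trans π.toEmbedding)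
    (s := (Finset.univ : Finset (Fin r ↪ ι))) (fun _ => Finset.mem_univ _) ?_ F
  · rwa [Finset.card_univ, Fintype.card_embedding_eq, Fintype.card_fin] at h
  · intro t _ t' _
    obtain ⟨τ, hτ⟩ := MulAction.isMultiplyPretransitive_iff.1
      (Equiv.Perm.isMultiplyPretransitive ι r) t t'
    refine ⟨⟨fun π => π.trans τ, fun π => π.trans τ.symm, fun π => by ext; simp,
      fun π => by ext; simp⟩, ?_⟩
    rintro π rfl
    rw [← hτ]
    rfl

variable {ι κ : Type*} [Fintype ι] [DecidableEq ι] [Fintype κ] [DecidableEq κ]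

omit [DecidableEq ι] in
lemma two_mul_card_eq_of_coordSum_eq_zero {x : ι → Bool} (hx : coordSum univ x = 0) (b : Bool) :
    2 * #{i | x i = b} = Fintype.card ι := by
  have h1 : ∑ i, boolSign (x i) = (#{i | x i = true} : ℝ) - #{i | x i = false} := by
    simp only [boolSign, Finset.sum_ite, Finset.sum_const, nsmul_eq_mul]
    simp [sub_eq_add_neg]
  rw [← coordSum_apply, hx] at h1
  have h2 : #{i | x i = true} = #{i | x i = false} := by
    have : (#{i | x i = true} : ℝ) = #{i | x i = false} := by linarith
    exact_mod_cast this
  have h3 := Finset.card_filter_add_card_filter_not (s := (univ : Finset ι)) (fun i => x i = true)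
  simp only [Bool.not_eq_true, Finset.card_univ] at h3
  cases b <;> omega

omit [DecidableEq ι] in
lemma exists_comp_perm_eq {x x' : ι → Bool} (hx : coordSum univ x = 0)
    (hx' : coordSum univ x' = 0) : ∃ τ : Equiv.Perm ι, ∀ i, x' (τ i) = x i := by
  have h : ∀ b, Nonempty ({i // x i = b} ≃ {i // x' i = b}) := by
    intro b
    refine ⟨Fintype.equivOfCardEq ?_⟩
    rw [Fintype.card_subtype, Fintype.card_subtype]
    have := two_mul_card_eq_of_coordSum_eq_zero hx b
    have := two_mul_card_eq_of_coordSum_eq_zero hx' b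
    omega
  have e := fun b => (h b).some
  exact ⟨Equiv.ofFiberEquiv e, fun i => Equiv.ofFiberEquiv_map e i⟩

/-- The balanced point on the points paired by `π : κ × Bool ≃ ι` in which the values on the two
points of pair `k` are opposite and determined by `y k`. -/
def pairPoint (π : κ × Bool ≃ ι) (y : κ → Bool) : ι → Bool :=
  substCube (fun i => (π.symm i).1) (fun i => (π.symm i).2) y

omit [Fintype ι] [DecidableEq ι] [Fintype κ] [DecidableEq κ] in
lemma pairPoint_apply (π : κ × Bool ≃ ι) (y : κ → Bool) (p : κ × Bool) :
    pairPoint π y (π p) = (y p.1 == p.2) := by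
  simp [pairPoint, substCube]

omit [DecidableEq ι] [DecidableEq κ] in
lemma coordSum_pairPoint (π : κ × Bool ≃ ι) (y : κ → Bool) :
    coordSum univ (pairPoint π y) = 0 := by
  rw [coordSum_apply, ← π.sum_comp]
  simp only [pairPoint_apply, Fintype.sum_prod_type, Fintype.sum_bool]
  refine Finset.sum_eq_zero fun k _ => ?_
  cases y k <;> norm_num [boolSign]

omit [Fintype ι] [DecidableEq ι] [Fintype κ] [DecidableEq κ] in
lemma pairPoint_trans_apply (π : κ × Bool ≃ ι) (τ : Equiv.Perm ι) (y : κ → Bool) (i : ι) :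
    pairPoint (π.trans τ) y (τ i) = pairPoint π y i := by
  simp [pairPoint, substCube]

omit [Fintype ι] [Fintype κ] in
lemma pairPoint_flipAt (π : κ × Bool ≃ ι) (k : κ) (y : κ → Bool) :
    pairPoint π (flipAt k y) = pairPoint π y ∘ Equiv.swap (π (k, true)) (π (k, false)) := by
  ext i
  obtain ⟨⟨l, b⟩, rfl⟩ := π.surjective i
  rw [Function.comp_apply, pairPoint_apply, Function.Injective.swap_apply π.injective,
    pairPoint_apply]
  by_cases hl : l = k
  · subst hl
    cases b <;> simp [flipAt]
  · rw [Equiv.swap_apply_of_ne_of_ne (by simp [hl]) (by simp [hl])]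
    simp [flipAt, hl]

lemma card_mul_sum_pairPoint (z : ι → Bool) (y : κ → Bool) (F : (ι → Bool) → ℝ) :
    #(balSlice univ z) * ∑ π : κ × Bool ≃ ι, F (pairPoint π y)
      = Fintype.card (κ × Bool ≃ ι) * ∑ x ∈ balSlice univ z, F x := by
  refine card_mul_sum_comp_eq (φ := fun π : κ × Bool ≃ ι => pairPoint π y) (fun π => ?_) ?_ F
  · simp [mem_balSlice, coordSum_pairPoint]
  · intro x hx x' hx'
    obtain ⟨τ, hτ⟩ := exists_comp_perm_eq (mem_balSlice.1 hx).2 (mem_balSlice.1 hx').2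
    refine ⟨⟨fun π => π.trans τ, fun π => π.trans τ.symm, fun π => by ext; simp,
      fun π => by ext; simp⟩, ?_⟩
    rintro π rfl
    ext i
    obtain ⟨i, rfl⟩ := τ.surjective i
    exact (pairPoint_trans_apply π τ y i).trans (hτ i).symm

/-- The triples consisting of a balanced point and a positive and a negative coordinate of it. -/
noncomputable def swapTriples (z : ι → Bool) : Finset ((ι → Bool) × ι × ι) :=
  {p ∈ balSlice univ z ×ˢ univ ×ˢ univ | p.1 p.2.1 = true ∧ p.1 p.2.2 = false}

lemma mem_swapTriples {z x : ι → Bool} {i j : ι} :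
    (x, i, j) ∈ swapTriples z ↔ x ∈ balSlice univ z ∧ x i = true ∧ x j = false := by
  simp [swapTriples]

lemma sum_swapTriples (z : ι → Bool) (F : (ι → Bool) × ι × ι → ℝ) :
    ∑ p ∈ swapTriples z, F p =
      ∑ i, ∑ j, ∑ x ∈ balSlice univ z with x i = true ∧ x j = false, F (x, i, j) := by
  rw [swapTriples, Finset.sum_filter, Finset.sum_product_right, Finset.sum_product]
  simp_rw [Finset.sum_filter]

lemma four_mul_card_swapTriples (z : ι → Bool) :
    4 * #(swapTriples z) = #(balSlice univ z) * (Fintype.card ι) ^ 2 := by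
  have : #(swapTriples z) = ∑ x ∈ balSlice univ z, #{i | x i = true} * #{j | x j = false} := by
    rw [Finset.card_eq_sum_card_fiberwise (f := Prod.fst) (t := balSlice univ z)]
    · refine Finset.sum_congr rfl fun x hx => ?_
      rw [← Finset.card_product]
      refine Finset.card_bij' (fun p _ => p.2) (fun q _ => (x, q)) ?_ ?_ ?_ ?_
      · rintro ⟨x', i, j⟩ hp
        simp only [Finset.mem_filter, mem_swapTriples] at hp
        obtain ⟨hp, rfl⟩ := hp
        simpa using hp.2
      · rintro ⟨i, j⟩ hp
        simp only [Finset.mem_filter, mem_swapTriples]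
        simpa [hx] using hp
      · rintro ⟨x', i, j⟩ hp
        simp only [Finset.mem_filter] at hp
        simp [hp.2]
      · rintro ⟨i, j⟩ _
        rfl
    · rintro ⟨x, i, j⟩ hp
      exact (mem_swapTriples.1 hp).1
  rw [this, Finset.mul_sum, Finset.card_eq_sum_ones, Finset.sum_mul]
  refine Finset.sum_congr rfl fun x hx => ?_
  have h1 := two_mul_card_eq_of_coordSum_eq_zero (mem_balSlice.1 hx).2 true
  have h2 := two_mul_card_eq_of_coordSum_eq_zero (mem_balSlice.1 hx).2 false
  rw [one_mul, sq]
  nth_rewrite 1 [← h1]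
  rw [← h2]
  ring

lemma card_mul_sum_pairPoint_swap (z : ι → Bool) (k : κ) (F : (ι → Bool) × ι × ι → ℝ) :
    #(swapTriples z) * ∑ π : κ × Bool ≃ ι,
        F (pairPoint π (fun _ => true), π (k, true), π (k, false))
      = Fintype.card (κ × Bool ≃ ι) * ∑ p ∈ swapTriples z, F p := by
  refine card_mul_sum_comp_eq (φ := fun π : κ × Bool ≃ ι =>
    (pairPoint π (fun _ => true), π (k, true), π (k, false))) (fun π => ?_) ?_ F
  · simp [mem_swapTriples, mem_balSlice, coordSum_pairPoint, pairPoint_apply]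
  · rintro ⟨x, i, j⟩ hx ⟨x', i', j'⟩ hx'
    rw [mem_swapTriples] at hx hx'
    obtain ⟨τ₀, hτ₀⟩ := exists_comp_perm_eq (mem_balSlice.1 hx.1).2 (mem_balSlice.1 hx'.1).2
    have hi := hτ₀ i
    have hj := hτ₀ j
    rw [hx.2.1] at hi
    rw [hx.2.2] at hj
    have hx'i := hx'.2.1
    have hx'j := hx'.2.2
    obtain ⟨τ, hτ, hτi, hτj⟩ : ∃ τ : Equiv.Perm ι, (∀ i, x' (τ i) = x i) ∧ τ i = i' ∧ τ j = j' := by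
      have hsw : ∀ a b c, x' a = x' b → x' (Equiv.swap a b c) = x' c := by
        intro a b c h
        rw [Equiv.swap_apply_def]
        split_ifs with h1 h2
        · rw [h1, h]
        · rw [h2, h]
        · rfl
      refine ⟨(τ₀.trans (Equiv.swap (τ₀ i) i')).trans (Equiv.swap (τ₀ j) j'), fun l => ?_, ?_, ?_⟩
      · simp only [Equiv.trans_apply]
        rw [hsw _ _ _ (hj.trans hx'j.symm), hsw _ _ _ (hi.trans hx'i.symm), hτ₀]
      · simp only [Equiv.trans_apply, Equiv.swap_apply_left]
        exact Equiv.swap_apply_of_ne_of_ne (by rintro h; rw [h, hj] at hx'i; cases hx'i)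
          (by rintro h; rw [h, hx'j] at hx'i; cases hx'i)
      · simp only [Equiv.trans_apply]
        rw [Equiv.swap_apply_of_ne_of_ne (a := τ₀ i), Equiv.swap_apply_left]
        · intro h; rw [h, hi] at hj; cases hj
        · rintro h; rw [h, hx'i] at hj; cases hj
    refine ⟨⟨fun π => π.trans τ, fun π => π.trans τ.symm, fun π => by ext; simp,
      fun π => by ext; simp⟩, ?_⟩
    intro π hπ
    simp only [Prod.mk.injEq] at hπ ⊢
    obtain ⟨hπx, rfl, rfl⟩ := hπ
    refine ⟨?_, by simpa using hτi, by simpa using hτj⟩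
    subst hπx
    ext l
    obtain ⟨l, rfl⟩ := τ.surjective l
    exact (pairPoint_trans_apply π τ _ l).trans (hτ l).symm

end Pairing

section Moments

variable {ι κ : Type*} [Fintype ι] [DecidableEq ι] [Fintype κ] [DecidableEq κ]

/-- The pairs of variables whose transposition changes `f` on the balanced points. -/
noncomputable def sensitivePairs (f : (ι → Bool) → ℝ) : Finset (ι × ι) :=
  open Classical in {p | ∃ x, coordSum univ x = 0 ∧ f (x ∘ Equiv.swap p.1 p.2) ≠ f x}

lemma mem_sensitivePairs {f : (ι → Bool) → ℝ} {i j : ι} :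
    (i, j) ∈ sensitivePairs f ↔ ∃ x, coordSum univ x = 0 ∧ f (x ∘ Equiv.swap i j) ≠ f x := by
  simp [sensitivePairs]

lemma mem_relevantVars {f : (ι → Bool) → ℝ} {i : ι} :
    i ∈ relevantVars f ↔ ∃ x, f (flipAt i x) ≠ f x := by
  simp [relevantVars]

/-- The number of pairs of `π` on which `f`, restricted to the points `pairPoint π y`, depends. -/
noncomputable def relevantCount (f : (ι → Bool) → ℝ) (π : κ × Bool ≃ ι) : ℕ :=
  #(relevantVars fun y => f (pairPoint π y))

lemma relevantCount_le_sum (f : (ι → Bool) → ℝ) (π : κ × Bool ≃ ι) :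
    (relevantCount f π : ℝ) ≤
      ∑ k, if (π (k, true), π (k, false)) ∈ sensitivePairs f then 1 else 0 := by
  rw [Finset.sum_boole, relevantCount]
  refine Nat.cast_le.2 (Finset.card_le_card fun k hk => ?_)
  obtain ⟨y, hy⟩ := mem_relevantVars.1 hk
  rw [pairPoint_flipAt] at hy
  simpa using mem_sensitivePairs.2 ⟨_, coordSum_pairPoint π y, hy⟩

omit [Fintype ι] in
lemma sum_le_relevantCount (f : (ι → Bool) → ℝ) (π : κ × Bool ≃ ι) :
    open Classical in (∑ k, if f (pairPoint π (fun _ => true) ∘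
      Equiv.swap (π (k, true)) (π (k, false))) ≠ f (pairPoint π fun _ => true) then (1 : ℝ) else 0)
      ≤ relevantCount f π := by
  classical
  rw [Finset.sum_boole, relevantCount]
  refine Nat.cast_le.2 (Finset.card_le_card fun k hk => ?_)
  rw [Finset.mem_filter] at hk
  exact mem_relevantVars.2 ⟨fun _ => true, by rw [pairPoint_flipAt]; exact hk.2⟩

lemma card_mul_card_sensitivePairs_le {d : ℕ} {f : (ι → Bool) → ℝ}
    (hf : f ∈ polyLT univ (d + 1 + 1)) (hι : Fintype.card ι = 2 * Fintype.card κ)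
    (hκ : 0 < Fintype.card κ) :
    (Fintype.card (κ × Bool ≃ ι) : ℝ) * #(sensitivePairs f) ≤
      4 ^ (d + 1) * Fintype.card κ * ∑ π : κ × Bool ≃ ι, (relevantCount f π : ℝ) := by
  classical
  set z : ι → Bool := fun _ => true
  set F : (ι → Bool) × ι × ι → ℝ :=
    fun p => if f (p.1 ∘ Equiv.swap p.2.1 p.2.2) ≠ f p.1 then 1 else 0 with hF
  set s : ℝ := ((#(balSlice univ z) : ℕ) : ℝ) with hs
  have hs0 : 0 < s := by
    have heven : Even #(univ : Finset ι) := by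
      rw [Finset.card_univ, hι]; exact even_two_mul _
    obtain ⟨x, hx⟩ := exists_coordSum_eq_zero heven
    exact Nat.cast_pos.2 (Finset.card_pos.2 ⟨x, by simpa [mem_balSlice] using hx⟩)
  have hcard : (#(swapTriples z) : ℝ) = s * (Fintype.card κ : ℝ) ^ 2 := by
    have h := four_mul_card_swapTriples z
    rw [hι] at h
    have h' : (4 * #(swapTriples z) : ℝ) = s * (2 * Fintype.card κ) ^ 2 := by
      rw [hs]; exact_mod_cast h
    linarith
  have hlow : s * #(sensitivePairs f) ≤ 4 ^ (d + 1) * ∑ p ∈ swapTriples z, F p := by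
    have hg : ∀ p ∈ sensitivePairs f, s ≤ 4 ^ (d + 1) *
        ∑ x ∈ balSlice univ z with x p.1 = true ∧ x p.2 = false, F (x, p) := by
      rintro ⟨i, j⟩ hij
      obtain ⟨x, hx, hfx⟩ := mem_sensitivePairs.1 hij
      have h := card_balSlice_le_card_swap_ne
        (fun V z g hg hne => card_balSlice_le_card_ne_zero d V z g hg hne) hf
        (Finset.mem_univ i) (Finset.mem_univ j) (z := z)
        ⟨x, by simpa [mem_balSlice] using hx, hfx⟩
      rw [hF, Finset.sum_boole, Finset.filter_filter]
      simp only [and_assoc]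
      rw [hs]
      exact_mod_cast h
    calc s * #(sensitivePairs f) = ∑ p ∈ sensitivePairs f, s := by simp [mul_comm]
      _ ≤ ∑ p ∈ sensitivePairs f, 4 ^ (d + 1) *
          ∑ x ∈ balSlice univ z with x p.1 = true ∧ x p.2 = false, F (x, p) :=
        Finset.sum_le_sum hg
      _ ≤ ∑ p : ι × ι, 4 ^ (d + 1) *
          ∑ x ∈ balSlice univ z with x p.1 = true ∧ x p.2 = false, F (x, p) := by
        refine Finset.sum_le_univ_sum_of_nonneg fun p => ?_
        refine mul_nonneg (by positivity) (Finset.sum_nonneg fun x _ => ?_)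
        rw [hF]; dsimp only; split_ifs <;> norm_num
      _ = _ := by rw [sum_swapTriples, ← Finset.mul_sum, Fintype.sum_prod_type]
  have hup : s * (Fintype.card κ : ℝ) ^ 2 * ∑ π : κ × Bool ≃ ι, (relevantCount f π : ℝ) ≥
      Fintype.card κ * (Fintype.card (κ × Bool ≃ ι) * ∑ p ∈ swapTriples z, F p) := by
    calc (Fintype.card κ : ℝ) * (Fintype.card (κ × Bool ≃ ι) * ∑ p ∈ swapTriples z, F p)
        = ∑ k : κ, (#(swapTriples z) : ℝ) * ∑ π : κ × Bool ≃ ι,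
            F (pairPoint π (fun _ => true), π (k, true), π (k, false)) := by
          simp_rw [card_mul_sum_pairPoint_swap]
          simp
      _ = s * (Fintype.card κ : ℝ) ^ 2 * ∑ π : κ × Bool ≃ ι, ∑ k,
            F (pairPoint π (fun _ => true), π (k, true), π (k, false)) := by
          rw [← Finset.mul_sum, Finset.sum_comm, hcard]
      _ ≤ _ := by
          gcongr with π
          exact sum_le_relevantCount f π
  have hm : (0 : ℝ) < Fintype.card κ := Nat.cast_pos.2 hκ
  set m : ℝ := ((Fintype.card κ : ℕ) : ℝ)
  set W : ℝ := ((Fintype.card (κ × Bool ≃ ι) : ℕ) : ℝ)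
  set N := ∑ π : κ × Bool ≃ ι, (relevantCount f π : ℝ)
  set P := ∑ p ∈ swapTriples z, F p
  have h1 : W * (s * #(sensitivePairs f)) ≤ W * (4 ^ (d + 1) * P) := by gcongr
  have h2 : W * P ≤ s * m * N := by
    refine le_of_mul_le_mul_left ?_ hm
    calc m * (W * P) ≤ _ := hup
      _ = _ := by ring
  refine le_of_mul_le_mul_left ?_ hs0
  calc s * (W * #(sensitivePairs f)) = W * (s * #(sensitivePairs f)) := by ring
    _ ≤ W * (4 ^ (d + 1) * P) := h1
    _ = 4 ^ (d + 1) * (W * P) := by ring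
    _ ≤ 4 ^ (d + 1) * (s * m * N) := by gcongr
    _ = _ := by ring

lemma sum_sensitive_le (f : (ι → Bool) → ℝ) (k : κ) :
    ((Fintype.card ι).descFactorial 2 : ℝ) * ∑ π : κ × Bool ≃ ι,
      (if (π (k, true), π (k, false)) ∈ sensitivePairs f then 1 else 0) ≤
      Fintype.card (κ × Bool ≃ ι) * #(sensitivePairs f) := by
  let e : Fin 2 ↪ κ × Bool := ⟨![(k, true), (k, false)], by
    intro a b; fin_cases a <;> fin_cases b <;> simp⟩
  have h := card_mul_sum_embedding_eq (ι := ι) e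
    fun e' => if (e' 0, e' 1) ∈ sensitivePairs f then (1 : ℝ) else 0
  refine (le_of_eq h).trans ?_
  gcongr
  rw [Finset.sum_boole]
  refine Nat.cast_le.2 (Finset.card_le_card_of_injOn (fun e' => (e' 0, e' 1)) ?_ ?_)
  · intro e' he'
    simpa using he'
  · intro a _ b _ hab
    simp only [Prod.mk.injEq] at hab
    ext l
    fin_cases l
    · exact hab.1
    · exact hab.2

lemma sum_sensitive_mul_le (f : (ι → Bool) → ℝ) {k l : κ} (hkl : k ≠ l) :
    ((Fintype.card ι).descFactorial 4 : ℝ) * ∑ π : κ × Bool ≃ ι,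
      (if (π (k, true), π (k, false)) ∈ sensitivePairs f then 1 else 0) *
        (if (π (l, true), π (l, false)) ∈ sensitivePairs f then 1 else 0) ≤
      Fintype.card (κ × Bool ≃ ι) * (#(sensitivePairs f) : ℝ) ^ 2 := by
  let e : Fin 4 ↪ κ × Bool := ⟨![(k, true), (k, false), (l, true), (l, false)], by
    intro a b; fin_cases a <;> fin_cases b <;> simp [hkl, hkl.symm]⟩
  have h := card_mul_sum_embedding_eq (ι := ι) e
    fun e' => (if (e' 0, e' 1) ∈ sensitivePairs f then (1 : ℝ) else 0) *
      if (e' 2, e' 3) ∈ sensitivePairs f then (1 : ℝ) else 0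
  refine (le_of_eq h).trans ?_
  gcongr
  simp_rw [ite_zero_mul_ite_zero, mul_one]
  rw [Finset.sum_boole, sq, ← Nat.cast_mul, ← Finset.card_product]
  refine Nat.cast_le.2 (Finset.card_le_card_of_injOn
    (fun e' => ((e' 0, e' 1), (e' 2, e' 3))) ?_ ?_)
  · intro e' he'
    simpa using he'
  · intro a _ b _ hab
    simp only [Prod.mk.injEq] at hab
    ext l
    fin_cases l
    · exact hab.1.1
    · exact hab.1.2
    · exact hab.2.1
    · exact hab.2.2

lemma sum_relevantCount_sq_le (f : (ι → Bool) → ℝ) (hι : Fintype.card ι = 2 * Fintype.card κ)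
    (hκ : 3 ≤ Fintype.card κ) {β : ℝ} (hβ : 0 ≤ β)
    (hB : (#(sensitivePairs f) : ℝ) = Fintype.card ι * β) :
    ∑ π : κ × Bool ≃ ι, (relevantCount f π : ℝ) ^ 2 ≤
      Fintype.card (κ × Bool ≃ ι) * (β + β ^ 2) := by
  classical
  obtain ⟨a, ha⟩ := Nat.exists_eq_add_of_le hκ
  set b : (κ × Bool ≃ ι) → κ → ℝ :=
    fun π k => if (π (k, true), π (k, false)) ∈ sensitivePairs f then 1 else 0
  set W : ℝ := ((Fintype.card (κ × Bool ≃ ι) : ℕ) : ℝ)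
  have hn : Fintype.card ι = 2 * a + 6 := by omega
  rw [hn] at hB
  push_cast at hB
  have h2 : ((Fintype.card ι).descFactorial 2 : ℝ) = (2 * a + 6) * (2 * a + 5) := by
    rw [hn]; simp [Nat.descFactorial]; ring
  have h4 : ((Fintype.card ι).descFactorial 4 : ℝ) =
      (2 * a + 6) * (2 * a + 5) * (2 * a + 4) * (2 * a + 3) := by
    rw [hn]; simp [Nat.descFactorial]; ring
  have hdiag : ∀ k, ∑ π, b π k ≤ W * β / (2 * a + 5) := by
    intro k
    have h := sum_sensitive_le f k
    rw [h2, hB] at h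
    rw [le_div_iff₀ (by positivity)]
    have h6 : (0 : ℝ) < 2 * a + 6 := by positivity
    refine le_of_mul_le_mul_left ?_ h6
    calc _ = (2 * a + 6) * (2 * a + 5) * ∑ π, b π k := by ring
      _ ≤ _ := h
      _ = _ := by ring
  have hoff : ∀ k l, k ≠ l → ∑ π, b π k * b π l ≤
      W * β ^ 2 * (2 * a + 6) / ((2 * a + 5) * (2 * a + 4) * (2 * a + 3)) := by
    intro k l hkl
    have h := sum_sensitive_mul_le f hkl
    rw [h4, hB] at h
    rw [le_div_iff₀ (by positivity)]
    have h6 : (0 : ℝ) < 2 * a + 6 := by positivity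
    refine le_of_mul_le_mul_left ?_ h6
    calc _ = (2 * a + 6) * (2 * a + 5) * (2 * a + 4) * (2 * a + 3) * ∑ π, b π k * b π l := by ring
      _ ≤ _ := h
      _ = _ := by ring
  set P := W * β / (2 * a + 5) with hP
  set Q := W * β ^ 2 * (2 * a + 6) / ((2 * a + 5) * (2 * a + 4) * (2 * a + 3)) with hQ
  have hW : 0 ≤ W := Nat.cast_nonneg _
  have hP0 : 0 ≤ P := by positivity
  have hQ0 : 0 ≤ Q := by positivity
  calc ∑ π : κ × Bool ≃ ι, (relevantCount f π : ℝ) ^ 2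
      ≤ ∑ π, (∑ k, b π k) ^ 2 := by
        gcongr with π
        exact relevantCount_le_sum f π
    _ = ∑ k, ∑ l, ∑ π, b π k * b π l := by
        simp_rw [sq, Finset.sum_mul_sum]
        rw [Finset.sum_comm]
        refine Finset.sum_congr rfl fun k _ => Finset.sum_comm
    _ ≤ ∑ k : κ, ∑ l : κ, ((if k = l then P else 0) + Q) := by
        gcongr with k _ l _
        split_ifs with hkl
        · subst hkl
          have : ∀ π, b π k * b π k = b π k := fun π => by
            simp only [b]; split_ifs <;> simp
          simp_rw [this]
          linarith [hdiag k]
        · linarith [hoff k l hkl]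
    _ = (a + 3) * P + (a + 3) ^ 2 * Q := by
        simp only [Finset.sum_add_distrib, Finset.sum_ite_eq, Finset.mem_univ, if_true,
          Finset.sum_const, Finset.card_univ, ha, nsmul_eq_mul]
        push_cast
        ring
    _ ≤ W * β + W * β ^ 2 := by
        have ha0 : (0 : ℝ) ≤ a := Nat.cast_nonneg a
        refine add_le_add ?_ ?_
        · rw [hP, mul_div_assoc', div_le_iff₀ (by positivity)]
          have : 0 ≤ W * β * (a + 2) := by positivity
          linarith
        · rw [hQ, mul_div_assoc', div_le_iff₀ (by positivity)]
          have : 0 ≤ W * β ^ 2 * (6 * a ^ 3 + 30 * a ^ 2 + 40 * a + 6) := by positivity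
          linarith
    _ = _ := by ring

end Moments

section SensitivePairs

variable {ι κ : Type*} [Fintype ι] [DecidableEq ι] [Fintype κ] [DecidableEq κ]

lemma sum_cubeMean_pairPoint (z : ι → Bool) (f : (ι → Bool) → ℝ) :
    #(balSlice univ z) * ∑ π : κ × Bool ≃ ι, cubeMean (fun y => f (pairPoint π y))
      = Fintype.card (κ × Bool ≃ ι) * ∑ x ∈ balSlice univ z, f x := by
  simp_rw [cubeMean_apply]
  rw [← Finset.mul_sum, Finset.sum_comm, mul_left_comm, Finset.mul_sum,
    Finset.sum_congr rfl fun y _ => card_mul_sum_pairPoint z y f, Finset.sum_const,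
    Finset.card_univ, nsmul_eq_mul, inv_mul_cancel_left₀ card_cube_pos.ne']

lemma sqrt_relevantCount_le {d : ℕ} {c : Finset ι → ℝ} (hdeg : ∀ S, d < #S → c S = 0) {γ : ℝ}
    (hγ : 0 < γ) (hmult : ∀ S, ∃ z : ℤ, c S = z * γ) {M : ℝ}
    (hM : ∀ x, coordSum univ x = 0 → (∑ S, c S • chi S) x ≤ M) (π : κ × Bool ≃ ι) :
    √(relevantCount (∑ S, c S • chi S) π) ≤ √(d * 9 ^ (d + 1)) / γ *
      (2 * (M - cubeMean (fun y => (∑ S, c S • chi S) (pairPoint π y)))) := by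
  set q : (κ → Bool) → ℝ := fun y => (∑ S, c S • chi S) (pairPoint π y) with hq
  have h1 : (#(relevantVars q) : ℝ) * γ ^ 2 ≤
      d * 9 ^ (d + 1) * cubeMean (fun x => |q x - cubeMean q|) ^ 2 :=
    card_relevantVars_mul_le (substCube_mem_polyLT hdeg _ _) hγ
      (exists_coeff_substCube hmult _ _)
  have h2 : cubeMean (fun x => |q x - cubeMean q|) ≤ 2 * (M - cubeMean q) :=
    cubeMean_abs_sub_le fun y => hM _ (coordSum_pairPoint π y)
  have h0 : 0 ≤ cubeMean (fun x => |q x - cubeMean q|) := cubeMean_nonneg fun x => abs_nonneg _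
  refine le_trans ?_ (mul_le_mul_of_nonneg_left h2 (by positivity))
  refine Real.sqrt_le_iff.2 ⟨by positivity, ?_⟩
  rw [mul_pow, div_pow, Real.sq_sqrt (by positivity), div_mul_eq_mul_div,
    le_div_iff₀ (by positivity)]
  exact h1

lemma sum_sqrt_relevantCount_le {d : ℕ} {c : Finset ι → ℝ} (hdeg : ∀ S, d < #S → c S = 0) {γ : ℝ}
    (hγ : 0 < γ) (hmult : ∀ S, ∃ z : ℤ, c S = z * γ) {z : ι → Bool} {t : ℝ}
    (hne : (balSlice univ z).Nonempty)
    (ht : ∀ x, coordSum univ x = 0 → (∑ S, c S • chi S) x ≤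
      (∑ x ∈ balSlice univ z, (∑ S, c S • chi S) x) / #(balSlice univ z) + t) :
    ∑ π : κ × Bool ≃ ι, √(relevantCount (∑ S, c S • chi S) π) ≤
      Fintype.card (κ × Bool ≃ ι) * (√(d * 9 ^ (d + 1)) / γ * (2 * t)) := by
  set f := ∑ S, c S • chi S
  have hs : (0 : ℝ) < #(balSlice univ z) := Nat.cast_pos.2 (Finset.card_pos.2 hne)
  have hmean := sum_cubeMean_pairPoint (κ := κ) z f
  refine (Finset.sum_le_sum fun π _ => sqrt_relevantCount_le hdeg hγ hmult ht π).trans_eq ?_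
  rw [← Finset.mul_sum, ← Finset.mul_sum, Finset.sum_sub_distrib, Finset.sum_const,
    Finset.card_univ, nsmul_eq_mul]
  have : ∑ π : κ × Bool ≃ ι, cubeMean (fun y => f (pairPoint π y)) =
      Fintype.card (κ × Bool ≃ ι) *
        ((∑ x ∈ balSlice univ z, f x) / #(balSlice univ z)) := by
    rw [mul_div_assoc', eq_div_iff hs.ne', ← hmean, mul_comm]
  rw [this]
  ring

/-- Boundedness from above on the balanced points bounds the number of sensitive pairs. -/
theorem card_sensitivePairs_le {d : ℕ} {c : Finset ι → ℝ} (hdeg : ∀ S, d + 1 < #S → c S = 0)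
    {γ : ℝ} (hγ : 0 < γ) (hmult : ∀ S, ∃ z : ℤ, c S = z * γ)
    (hι : Fintype.card ι = 2 * Fintype.card κ) (hκ : 3 ≤ Fintype.card κ) {z : ι → Bool} {t : ℝ}
    (ht1 : 1 ≤ t) (ht : ∀ x, coordSum univ x = 0 → (∑ S, c S • chi S) x ≤
      (∑ x ∈ balSlice univ z, (∑ S, c S • chi S) x) / #(balSlice univ z) + t) :
    (#(sensitivePairs (∑ S, c S • chi S)) : ℝ) ≤ Fintype.card ι *
      ((1 + 64 ^ (d + 1) * ((d + 1 : ℕ) * 9 ^ (d + 2) / γ ^ 2)) * t ^ 2) := by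
  have hne : (balSlice univ z).Nonempty := by
    have heven : Even #(univ : Finset ι) := by
      rw [Finset.card_univ, hι]; exact even_two_mul _
    obtain ⟨x, hx⟩ := exists_coordSum_eq_zero heven
    exact ⟨x, by simpa [mem_balSlice] using hx⟩
  have hf : ∑ S, c S • chi S ∈ polyLT univ (d + 1 + 1) := by
    refine Submodule.sum_mem _ fun S _ => ?_
    by_cases hS : d + 1 < #S
    · simp [hdeg S hS]
    · exact Submodule.smul_mem _ _ (chi_mem_polyLT (Finset.subset_univ S) (by omega))
  have hhalf := sum_sqrt_relevantCount_le (κ := κ) hdeg hγ hmult hne ht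
  set f := ∑ S, c S • chi S
  have hm : (0 : ℝ) < Fintype.card κ := Nat.cast_pos.2 (by omega)
  have hn : (Fintype.card ι : ℝ) = 2 * Fintype.card κ := by exact_mod_cast hι
  obtain ⟨β, hβ⟩ : ∃ β : ℝ, (#(sensitivePairs f) : ℝ) = Fintype.card ι * β :=
    ⟨#(sensitivePairs f) / Fintype.card ι, by rw [mul_div_cancel₀]; rw [hn]; positivity⟩
  have hn0 : (0 : ℝ) < Fintype.card ι := by rw [hn]; positivity
  have hβ0 : 0 ≤ β := by
    refine nonneg_of_mul_nonneg_right (a := (Fintype.card ι : ℝ)) ?_ hn0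
    rw [← hβ]; positivity
  have hfirst := card_mul_card_sensitivePairs_le hf hι (by omega)
  have hsecond := sum_relevantCount_sq_le f hι hκ hβ0 hβ
  have hW : (0 : ℝ) < Fintype.card (κ × Bool ≃ ι) := by
    have : Nonempty (κ × Bool ≃ ι) := ⟨Fintype.equivOfCardEq (by simp [hι, mul_comm])⟩
    exact Nat.cast_pos.2 Fintype.card_pos
  rw [hβ]
  refine mul_le_mul_of_nonneg_left ?_ hn0.le
  set K : ℝ := (d + 1 : ℕ) * 9 ^ (d + 2) / γ ^ 2 with hK
  have hK0 : 0 ≤ K := by positivity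
  have ht2 : 1 ≤ t ^ 2 := one_le_pow₀ ht1
  rcases le_total β 1 with hβ1 | hβ1
  · calc β ≤ 1 * 1 := by linarith
      _ ≤ _ := by gcongr; linarith [show 0 ≤ 64 ^ (d + 1) * K by positivity]
  have hholder := sum_sq_pow_three_le (univ : Finset (κ × Bool ≃ ι))
    (u := fun π => √(relevantCount f π : ℝ)) fun π _ => Real.sqrt_nonneg _
  have hsq : ∀ π : κ × Bool ≃ ι, √(relevantCount f π : ℝ) ^ 2 = relevantCount f π :=
    fun π => Real.sq_sqrt (Nat.cast_nonneg _)
  have hfour : ∀ π : κ × Bool ≃ ι, √(relevantCount f π : ℝ) ^ 4 = (relevantCount f π : ℝ) ^ 2 :=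
    fun π => by rw [show 4 = 2 * 2 from rfl, pow_mul, hsq]
  simp only [hsq, hfour] at hholder
  set W : ℝ := ((Fintype.card (κ × Bool ≃ ι) : ℕ) : ℝ)
  set N : ℝ := ∑ π : κ × Bool ≃ ι, (relevantCount f π : ℝ)
  have hN : 2 * W * β ≤ 4 ^ (d + 1) * N := by
    refine le_of_mul_le_mul_left ?_ hm
    calc _ = W * (Fintype.card ι * β) := by rw [hn]; ring
      _ ≤ 4 ^ (d + 1) * Fintype.card κ * N := by rw [← hβ]; exact hfirst
      _ = _ := by ring
  have hN0 : 0 < N := by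
    have : 0 < 4 ^ (d + 1) * N := lt_of_lt_of_le (by positivity) hN
    exact pos_of_mul_pos_right this (by positivity)
  have hhalf2 : (∑ π : κ × Bool ≃ ι, √(relevantCount f π : ℝ)) ^ 2 ≤ W ^ 2 * (K * (4 * t ^ 2)) := by
    calc _ ≤ (W * (√((d + 1 : ℕ) * 9 ^ (d + 1 + 1)) / γ * (2 * t))) ^ 2 := by
          gcongr
      _ = _ := by
          rw [mul_pow, mul_pow, div_pow, Real.sq_sqrt (by positivity), hK]; ring
  have hsec : W * ∑ π : κ × Bool ≃ ι, (relevantCount f π : ℝ) ^ 2 ≤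
      (4 ^ (d + 1) * N) ^ 2 / 2 := by
    calc _ ≤ W * (W * (β + β ^ 2)) := by gcongr
      _ ≤ W * (W * (2 * β ^ 2)) := by gcongr; nlinarith
      _ = (2 * W * β) ^ 2 / 2 := by ring
      _ ≤ _ := by gcongr
  have hNle : N ≤ W * (K * (2 * t ^ 2)) * (4 ^ (d + 1)) ^ 2 := by
    have : 0 < W * N ^ 2 := by positivity
    refine le_of_mul_le_mul_left ?_ this
    calc W * N ^ 2 * N = W * N ^ 3 := by ring
      _ ≤ W * ((∑ π : κ × Bool ≃ ι, √(relevantCount f π : ℝ)) ^ 2 *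
          ∑ π : κ × Bool ≃ ι, (relevantCount f π : ℝ) ^ 2) := by gcongr
      _ = (∑ π : κ × Bool ≃ ι, √(relevantCount f π : ℝ)) ^ 2 *
          (W * ∑ π : κ × Bool ≃ ι, (relevantCount f π : ℝ) ^ 2) := by ring
      _ ≤ W ^ 2 * (K * (4 * t ^ 2)) * ((4 ^ (d + 1) * N) ^ 2 / 2) := by gcongr
      _ = _ := by ring
  have h64 : (64 : ℝ) ^ (d + 1) = (4 ^ (d + 1)) ^ 3 := by
    rw [← pow_mul, mul_comm, pow_mul]; norm_num
  have : β ≤ 64 ^ (d + 1) * K * t ^ 2 := by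
    refine le_of_mul_le_mul_left ?_ (show 0 < 2 * W by positivity)
    calc _ ≤ 4 ^ (d + 1) * N := hN
      _ ≤ 4 ^ (d + 1) * (W * (K * (2 * t ^ 2)) * (4 ^ (d + 1)) ^ 2) := by gcongr
      _ = _ := by rw [h64]; ring
  calc β ≤ _ := this
    _ ≤ _ := by gcongr; linarith

end SensitivePairs

section Junta

variable {ι : Type*} [Fintype ι] [DecidableEq ι]

lemma notMem_sensitivePairs_iff {f : (ι → Bool) → ℝ} {i j : ι} :
    (i, j) ∉ sensitivePairs f ↔ ∀ x, coordSum univ x = 0 → f (x ∘ Equiv.swap i j) = f x := by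
  simp [mem_sensitivePairs]

lemma notMem_sensitivePairs_of_common {f : (ι → Bool) → ℝ} {i j k : ι}
    (hj : (i, j) ∉ sensitivePairs f) (hk : (i, k) ∉ sensitivePairs f) :
    (j, k) ∉ sensitivePairs f := by
  rw [notMem_sensitivePairs_iff] at hj hk ⊢
  intro x hx
  by_cases hki : k = i
  · rw [hki, Equiv.swap_comm, hj x hx]
  by_cases hkj : k = j
  · simp [hkj]
  have h0 : ∀ (y : ι → Bool) (l : ι), coordSum univ y = 0 →
      coordSum univ (y ∘ Equiv.swap i l) = 0 := fun y l hy => by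
    rw [coordSum_comp_perm (fun _ _ => Finset.mem_univ _), hy]
  have hconj : Equiv.swap j k = Equiv.swap i j * Equiv.swap i k * (Equiv.swap i j)⁻¹ := by
    rw [← Equiv.swap_apply_apply, Equiv.swap_apply_left, Equiv.swap_apply_of_ne_of_ne hki hkj]
  rw [hconj, Equiv.swap_inv]
  calc f (x ∘ ⇑(Equiv.swap i j * Equiv.swap i k * Equiv.swap i j))
      = f (((x ∘ Equiv.swap i j) ∘ Equiv.swap i k) ∘ Equiv.swap i j) := rfl
    _ = f x := by rw [hj _ (h0 _ _ (h0 _ _ hx)), hk _ (h0 _ _ hx), hj x hx]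

lemma exists_card_mul_le [Nonempty ι] (P : Finset (ι × ι)) :
    ∃ i, Fintype.card ι * #{j | (i, j) ∈ P} ≤ #P := by
  by_contra! h
  have hsum : ∑ i, #{j | (i, j) ∈ P} = #P := by
    simp_rw [Finset.card_filter]
    rw [← Fintype.sum_prod_type' (f := fun i j => if (i, j) ∈ P then 1 else 0)]
    simp
  have := Finset.sum_lt_sum_of_nonempty Finset.univ_nonempty fun i (_ : i ∈ univ) => h i
  rw [← Finset.mul_sum, hsum, Finset.sum_const, Finset.card_univ, smul_eq_mul] at this
  exact lt_irrefl _ this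

/-- A polynomial with few sensitive pairs is a polynomial in few variables, modulo a multiple of the
sum of all the variables. -/
lemma exists_mem_sup_sumMultiples [Nonempty ι] (hι : Even (Fintype.card ι)) {d : ℕ}
    {f : (ι → Bool) → ℝ} (hf : f ∈ polyLT univ (d + 1)) :
    ∃ J : Finset ι, Fintype.card ι * #J ≤ #(sensitivePairs f) ∧
      f ∈ polyLT J (d + 1) ⊔ sumMultiples univ d := by
  obtain ⟨i, hi⟩ := exists_card_mul_le (sensitivePairs f)
  refine ⟨({j | (i, j) ∈ sensitivePairs f} : Finset ι), hi, ?_⟩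
  have h := mem_sup_sumMultiples (A := {j | (i, j) ∉ sensitivePairs f}) (Finset.subset_univ _)
    (by rwa [Finset.card_univ]) hf fun j hj k hk x hx => by
      simp only [Finset.mem_filter, Finset.mem_univ, true_and] at hj hk
      exact notMem_sensitivePairs_iff.1 (notMem_sensitivePairs_of_common hj hk) x hx
  convert h using 3
  ext j
  simp

lemma cubeMean_coordSum_mul_mul_chi (h : (ι → Bool) → ℝ) (T : Finset ι) :
    cubeMean (coordSum univ * h * chi T) = ∑ i, cubeMean (h * chi (symmDiff T {i})) := by
  rw [coordSum, Finset.sum_mul, Finset.sum_mul, map_sum]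
  refine Finset.sum_congr rfl fun i _ => ?_
  rw [← coord_mul_chi]
  congr 1
  ring

lemma cubeMean_sum_smul_chi_mul_chi (c : Finset ι → ℝ) (T : Finset ι) :
    cubeMean ((∑ S, c S • chi S) * chi T) = c T := by
  simp [Finset.sum_mul, cubeMean_chi_mul_chi]

end Junta

lemma evalML_signs {n : ℕ} (c : Finset (Fin n) → ℝ) (σ : Fin n → Bool) :
    evalML c (signs σ) = (∑ S, c S • chi S) σ := by
  simp only [evalML, Finset.sum_apply, Pi.smul_apply, smul_eq_mul]
  rfl

lemma intSum_eq_zero_iff {n : ℕ} (σ : Fin n → Bool) : intSum σ = 0 ↔ coordSum univ σ = 0 := by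
  have : ((intSum σ : ℤ) : ℝ) = coordSum univ σ := by
    rw [coordSum_apply, intSum]
    push_cast
    rfl
  rw [← this, Int.cast_eq_zero]

lemma bisSet_eq {n : ℕ} (z : Fin n → Bool) : bisSet n = balSlice univ z := by
  ext σ
  simp [bisSet, mem_balSlice, intSum_eq_zero_iff]

theorem stmt0 (d : ℕ) (hd : 1 ≤ d) :
    ∃ C : ℝ, 0 < C ∧
      ∀ t : ℝ, 1 ≤ t → ∃ n₀ : ℕ, ∀ n : ℕ, n₀ ≤ n → Even n →
        ∀ c : Finset (Fin n) → ℝ,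
          (∀ S, d < S.card → c S = 0) →
          (∀ S, ∃ m : ℤ, c S = m * (2 : ℝ) ^ (-(d : ℤ))) →
          (∃ σ : Fin n → Bool, intSum σ = 0 ∧
              evalML c (signs σ) ≥ expOver (bisSet n) (fun τ => evalML c (signs τ)) + t) ∨
          (∃ h : Finset (Fin n) → ℝ, (∀ S, d - 1 < S.card → h S = 0) ∧
              ({i : Fin n | ∃ S : Finset (Fin n), i ∈ S ∧
                  c S - (if S = (∅ : Finset (Fin n)) then c ∅ else 0) - mulSum h S ≠ 0}.ncard : ℝ)
                ≤ C * t ^ 2) := by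
  obtain ⟨e, rfl⟩ : ∃ e, d = e + 1 := ⟨d - 1, by omega⟩
  set γ : ℝ := (2 : ℝ) ^ (-((e + 1 : ℕ) : ℤ)) with hγ
  have hγ0 : 0 < γ := by positivity
  refine ⟨1 + 64 ^ (e + 1) * ((e + 1 : ℕ) * 9 ^ (e + 2) / γ ^ 2), by positivity,
    fun t ht1 => ⟨6, fun n hn6 hn c hdeg hmult => ?_⟩⟩
  rw [or_iff_not_imp_left]
  intro hlow
  obtain ⟨m, hm⟩ := hn
  have : NeZero n := ⟨by omega⟩
  have hcard : Fintype.card (Fin n) = 2 * Fintype.card (Fin m) := by simp; omega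
  have hle : ∀ x : Fin n → Bool, coordSum univ x = 0 → (∑ S, c S • chi S) x ≤
      (∑ x ∈ balSlice univ fun _ => true, (∑ S, c S • chi S) x) /
        #(balSlice univ fun _ : Fin n => true) + t := by
    intro x hx
    by_contra! hlt
    refine hlow ⟨x, (intSum_eq_zero_iff x).2 hx, ?_⟩
    simp only [evalML_signs, expOver, bisSet_eq fun _ => true]
    exact hlt.le
  have hpairs := card_sensitivePairs_le (κ := Fin m) hdeg hγ0 hmult hcard (by simp; omega) ht1 hle
  have hf : ∑ S, c S • chi S ∈ polyLT (univ : Finset (Fin n)) (e + 1 + 1) := by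
    refine Submodule.sum_mem _ fun S _ => ?_
    by_cases hS : e + 1 < #S
    · simp [hdeg S hS]
    · exact Submodule.smul_mem _ _ (chi_mem_polyLT (Finset.subset_univ S) (by omega))
  obtain ⟨J, hJ, hmem⟩ := exists_mem_sup_sumMultiples (by simpa using ⟨m, hm⟩) hf
  obtain ⟨g, hg, s, hs, hgs⟩ := Submodule.mem_sup.1 hmem
  obtain ⟨h, hh, rfl⟩ := mem_sumMultiples.1 hs
  refine ⟨fun S => cubeMean (h * chi S), fun S hS =>
    cubeMean_mul_chi_eq_zero hh fun _ => by omega, ?_⟩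
  have hcoef : ∀ S, c S = cubeMean (g * chi S) + mulSum (fun S => cubeMean (h * chi S)) S := by
    intro S
    rw [← cubeMean_sum_smul_chi_mul_chi c S, ← hgs, add_mul, map_add,
      cubeMean_coordSum_mul_mul_chi]
    rfl
  have hsub : {i : Fin n | ∃ S : Finset (Fin n), i ∈ S ∧
      c S - (if S = (∅ : Finset (Fin n)) then c ∅ else 0) -
        mulSum (fun S => cubeMean (h * chi S)) S ≠ 0} ⊆ (J : Set (Fin n)) := by
    rintro i ⟨S, hiS, hne⟩
    by_contra hiJ
    apply hne
    have hSJ : ¬ S ⊆ J := fun hSJ => hiJ (hSJ hiS)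
    rw [if_neg (Finset.ne_empty_of_mem hiS), hcoef S,
      cubeMean_mul_chi_eq_zero hg fun hSJ' => absurd hSJ' hSJ]
    ring
  have hn0 : (0 : ℝ) < Fintype.card (Fin n) := Nat.cast_pos.2 Fintype.card_pos
  refine le_of_mul_le_mul_left (le_trans ?_ hpairs) hn0
  refine le_trans ?_ (Nat.cast_le.2 hJ)
  rw [Nat.cast_mul]
  gcongr
  calc _ ≤ (J : Set (Fin n)).ncard := Set.ncard_le_ncard hsub
    _ = #J := Set.ncard_coe_finset J
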